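/- For every compatible pair (𝔅, 𝔅′) of base sets there exists a Rajchman probability measure supported on the partly normal numbers 𝒩(𝔅, 𝔅′). Precisely: let 𝔅, 𝔅′ ⊆ {2,3,4,…} with 𝔅 ∪ 𝔅′ ≠ ∅ and with log b / log b′ irrational for every (b, b′) ∈ 𝔅 × 𝔅′ (this holds vacuously if one of the sets is empty); if 𝔅′ = ∅ replace 𝔅 by all of {2,3,4,…}, and if 𝔅 = ∅ replace 𝔅′ by all of {2,3,4,…}. Then there exists a Borel probability measure μ on [0,1) with μ̂(n) → 0 as |n| → ∞ through integers n, such that for μ-almost every x ∈ [0,1): x is b-normal for every b ∈ 𝔅 and x is not b′-normal for any b′ ∈ 𝔅′. In particular (the case 𝔅 = ∅), the set of numbers in [0,1) that are non-normal in every integer base b ≥ 2 supports a Rajchman measure. -/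

import Mathlib

open MeasureTheory Filter Finset

/-- `e(y) = exp(-2πi y)`. -/
noncomputable def eneg (y : ℝ) : ℂ := Complex.exp (-(2 * Real.pi * Complex.I * (y : ℂ)))

/-- The `n`-th Fourier coefficient of a measure: `ν̂(n) = ∫ e(nx) dν(x)`. -/
noncomputable def muHat (μ : Measure ℝ) (n : ℤ) : ℂ := ∫ x, eneg ((n : ℝ) * x) ∂μ

/-- A measure is Rajchman if its Fourier coefficients tend to `0` as `|n| → ∞`,
i.e. along the cofinite filter on `ℤ`. -/
def Rajchman (μ : Measure ℝ) : Prop :=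
  Tendsto (fun n : ℤ => muHat μ n) cofinite (nhds 0)

/-- The `j`-th digit (for `j ≥ 1`) of the fractional part of `x` in base `b`. -/
noncomputable def digit (b : ℕ) (x : ℝ) (j : ℕ) : ℕ := ⌊Int.fract x * (b : ℝ) ^ j⌋₊ % b

/-- `x` is normal in base `b`: for every `k ≥ 1`, every block of `k` digits occurs with
limiting frequency `b^{-k}` in the base-`b` digit expansion of the fractional part of `x`. -/
def IsNormal (b : ℕ) (x : ℝ) : Prop :=
  ∀ k : ℕ, 1 ≤ k → ∀ d : Fin k → ℕ, (∀ i, d i < b) →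
    Tendsto (fun N : ℕ =>
      (((Finset.Icc 1 N).filter fun n => ∀ i : Fin k, digit b x (n + (i : ℕ)) = d i).card : ℝ) / N)
      atTop (nhds (1 / (b : ℝ) ^ k))



lemma arc_count (β : ℝ) (hβ : Irrational β) (lam : ℝ) (h0 : 0 < lam) (h1 : lam ≤ 1/4) :
    ∃ C : ℝ, 0 ≤ C ∧ ∀ (x : ℝ) (p : ℕ) (S : Finset ℕ),
      (∀ i ∈ S, p ≤ i ∧ i < 2 * p ∧ ∃ n : ℤ, x + i * β ≤ n ∧ (n : ℝ) ≤ x + i * β + lam) →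
      (S.card : ℝ) ≤ 4 * lam * p + C := by
  set m : ℕ := ⌊1 / (2 * lam)⌋₊ with hm
  have hm1 : (m : ℝ) ≤ 1 / (2 * lam) := Nat.floor_le (by positivity)
  have hm2 : 1 / (2 * lam) < m + 1 := Nat.lt_floor_add_one _
  have hml : 2 * lam * m ≤ 1 := by
    rw [le_div_iff₀ (by positivity)] at hm1; linarith
  have hml2 : 1 ≤ 4 * lam * m := by
    rw [div_lt_iff₀ (by positivity)] at hm2; nlinarith
  have hd : Dense ((AddSubgroup.closure {β, 1} : AddSubgroup ℝ) : Set ℝ) := by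
    rw [dense_addSubgroupClosure_pair_iff]; simpa using hβ
  have hk : ∀ r : ℕ, ∃ k n : ℤ, |k * β + n - 2 * lam * r| < lam / 2 := by
    intro r
    obtain ⟨y, hy, hyd⟩ := hd.exists_dist_lt (2 * lam * r) (ε := lam / 2) (by positivity)
    obtain ⟨k, n, hkn⟩ := AddSubgroup.mem_closure_pair.1 hy
    refine ⟨k, n, ?_⟩
    rw [Real.dist_eq, abs_sub_comm] at hyd
    rw [← hkn] at hyd
    simpa using hyd
  choose k n hkn using hk
  set M : ℤ := ∑ r ∈ range m, |k r| with hM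
  have hkM : ∀ r ∈ range m, |k r| ≤ M := fun r hr =>
    Finset.single_le_sum (f := fun r => |k r|) (fun _ _ => abs_nonneg _) hr
  have hM0 : 0 ≤ M := Finset.sum_nonneg (fun _ _ => abs_nonneg _)
  have hM0' : (0:ℝ) ≤ M := by exact_mod_cast hM0
  refine ⟨4 * lam * (2 * M + 1), by positivity, ?_⟩
  intro x p S hS
  have hcard : (range m ×ˢ S).card ≤ (Finset.Icc ((p:ℤ) - M) (2 * p + M)).card := by
    apply Finset.card_le_card_of_injOn (fun z => (z.2 : ℤ) + k z.1)
    · rintro ⟨r, i⟩ hz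
      simp only [coe_product, Set.mem_prod, mem_coe] at hz
      have := hkM r hz.1
      have h2 := hS i hz.2
      rw [abs_le] at this
      simp only [coe_Icc, Set.mem_Icc]
      omega
    · rintro ⟨r, i⟩ hz ⟨r', i'⟩ hz' heq
      simp only [coe_product, Set.mem_prod, mem_coe] at hz hz' heq
      obtain ⟨-, -, a, ha1, ha2⟩ := hS i hz.2
      obtain ⟨-, -, a', ha1', ha2'⟩ := hS i' hz'.2
      have heq' : (i : ℝ) + k r = i' + k r' := by exact_mod_cast heq
      have h3 := abs_lt.1 (hkn r)
      have h4 := abs_lt.1 (hkn r')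
      -- (k r - k r') β = (i' - i) β
      have h5 : (k r : ℝ) * β - k r' * β = i' * β - i * β := by
        have : (k r : ℝ) - k r' = i' - i := by linarith
        rw [← sub_mul, this, sub_mul]
      have hrr : r = r' := by
        by_contra hne
        rcases Nat.lt_or_gt_of_ne hne with hlt | hlt
        · have hr' : (r' : ℝ) + 1 ≤ m := by exact_mod_cast (mem_range.1 hz'.1)
          have hlt' : (r : ℝ) + 1 ≤ r' := by exact_mod_cast hlt
          have hr0 : (0:ℝ) ≤ r := by positivity
          have q1 : lam * (r' - r) ≥ lam := by nlinarith
          have q2 : lam * (r' - r) ≤ 1/2 - lam := by nlinarith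
          have e1 : (0:ℝ) < ((n r' - n r - (a' - a) : ℤ) : ℝ) := by push_cast; linarith
          have e2 : ((n r' - n r - (a' - a) : ℤ) : ℝ) < 1 := by push_cast; linarith
          have e1' : (0:ℤ) < (n r' - n r - (a' - a) : ℤ) := by exact_mod_cast e1
          have e2' : (n r' - n r - (a' - a) : ℤ) < 1 := by exact_mod_cast e2
          omega
        · have hr' : (r : ℝ) + 1 ≤ m := by exact_mod_cast (mem_range.1 hz.1)
          have hlt' : (r' : ℝ) + 1 ≤ r := by exact_mod_cast hlt
          have hr0 : (0:ℝ) ≤ r' := by positivity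
          have q1 : lam * (r - r') ≥ lam := by nlinarith
          have q2 : lam * (r - r') ≤ 1/2 - lam := by nlinarith
          have e1 : (0:ℝ) < ((n r - n r' - (a - a') : ℤ) : ℝ) := by push_cast; linarith
          have e2 : ((n r - n r' - (a - a') : ℤ) : ℝ) < 1 := by push_cast; linarith
          have e1' : (0:ℤ) < (n r - n r' - (a - a') : ℤ) := by exact_mod_cast e1
          have e2' : (n r - n r' - (a - a') : ℤ) < 1 := by exact_mod_cast e2
          omega
      subst hrr
      simp only [add_left_inj, Nat.cast_inj] at heq
      rw [heq]
  rw [card_product, card_range, Int.card_Icc] at hcard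
  have hcard' : (m : ℝ) * S.card ≤ p + 2 * M + 1 := by
    have : ((m * S.card : ℕ) : ℤ) ≤ (p + 2 * M + 1 : ℤ) := by
      have h6 : (((2 * p + M + 1 - (p - M) : ℤ).toNat : ℕ) : ℤ) = p + 2 * M + 1 := by
        rw [Int.toNat_of_nonneg] <;> omega
      rw [← h6]; exact_mod_cast hcard
    exact_mod_cast this
  have hS0 : (0:ℝ) ≤ S.card := by positivity
  calc (S.card : ℝ) ≤ (4 * lam * m) * S.card := by nlinarith
    _ = 4 * lam * (m * S.card) := by ring
    _ ≤ 4 * lam * (p + 2 * M + 1) := by gcongr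
    _ = _ := by ring

/-- `GoodPair b h A Q U p n m` : the frequency `h (b^n - b^m)` is close to the spectrum. -/
def NearSpec (A Q U p : ℕ) (l : ℤ) : Prop :=
  ∃ i q : ℕ, p ≤ i ∧ i < 2 * p ∧ 1 ≤ q ∧ q ≤ Q ∧ |l - q * (A:ℤ) ^ i| * U ≤ 2 * (A:ℤ) ^ i

/-- consequences in real numbers -/
lemma nearSpec_real {b h A Q U : ℕ} (hb : 2 ≤ b) (hh : 1 ≤ h) (hU : 64 ≤ U)
    (hA : A = Q * U) (i q n d : ℕ) (hd : 1 ≤ d) (hdn : d ≤ n) (hq : 1 ≤ q) (hqQ : q ≤ Q)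
    (hl : |(h:ℤ) * ((b:ℤ) ^ n - (b:ℤ) ^ (n - d)) - q * (A:ℤ) ^ i| * U ≤ 2 * (A:ℤ) ^ i) :
    Real.log (q - 2 / U) ≤ Real.log (h * (1 - 1 / (b:ℝ) ^ d)) + n * Real.log b - i * Real.log A ∧
    Real.log (h * (1 - 1 / (b:ℝ) ^ d)) + n * Real.log b - i * Real.log A ≤ Real.log (q + 2 / U) := by
  have hbR : (2:ℝ) ≤ b := by exact_mod_cast hb
  have hUR : (64:ℝ) ≤ U := by exact_mod_cast hU
  have hqR : (1:ℝ) ≤ q := by exact_mod_cast hq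
  have hhR : (1:ℝ) ≤ h := by exact_mod_cast hh
  have hA1 : 1 ≤ A := by rw [hA]; nlinarith
  have hAR : (1:ℝ) ≤ A := by exact_mod_cast hA1
  have hApos : (0:ℝ) < (A:ℝ) ^ i := by positivity
  have hbd : (2:ℝ) ≤ (b:ℝ) ^ d := by
    calc (2:ℝ) ≤ b := hbR
      _ = (b:ℝ)^1 := by simp
      _ ≤ (b:ℝ)^d := pow_le_pow_right₀ (by linarith) hd
  have hinv : 1 / (b:ℝ) ^ d ≤ 1/2 := by
    rw [div_le_div_iff₀ (by positivity) (by positivity)]; linarith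
  have hc : 0 < (h:ℝ) * (1 - 1 / (b:ℝ) ^ d) := by
    apply mul_pos <;> linarith
  set c : ℝ := (h:ℝ) * (1 - 1 / (b:ℝ) ^ d) with hcdef
  have h2U : 2 / (U:ℝ) ≤ 1/32 := by
    rw [div_le_div_iff₀ (by positivity) (by positivity)]; linarith
  have h2U0 : 0 < 2 / (U:ℝ) := by positivity
  have hl' : |c * (b:ℝ) ^ n - q * (A:ℝ) ^ i| * U ≤ 2 * (A:ℝ) ^ i := by
    have e : c * (b:ℝ) ^ n = (h:ℝ) * ((b:ℝ) ^ n - (b:ℝ) ^ (n - d)) := by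
      have : (b:ℝ) ^ n = (b:ℝ) ^ (n - d) * (b:ℝ) ^ d := by rw [← pow_add]; congr 1; omega
      rw [hcdef, this]; field_simp
    rw [e]; exact_mod_cast hl
  have hl2 : |c * (b:ℝ) ^ n / (A:ℝ) ^ i - q| ≤ 2 / U := by
    rw [le_div_iff₀ (by positivity)]
    have : c * (b:ℝ) ^ n / (A:ℝ) ^ i - q = (c * (b:ℝ) ^ n - q * (A:ℝ) ^ i) / (A:ℝ) ^ i := by
      field_simp
    rw [this, abs_div, abs_of_pos hApos, div_mul_eq_mul_div, div_le_iff₀ hApos]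
    exact hl'
  clear_value c
  have hlog : Real.log c + n * Real.log b - i * Real.log A
      = Real.log (c * (b:ℝ) ^ n / (A:ℝ) ^ i) := by
    rw [Real.log_div (by positivity) (by positivity), Real.log_mul (by positivity) (by positivity),
      Real.log_pow, Real.log_pow]
  rw [hlog]
  rw [abs_le] at hl2
  constructor
  · apply Real.log_le_log <;> linarith
  · apply Real.log_le_log
    · positivity
    · linarith

set_option maxHeartbeats 1600000 in
lemma count_pairs {b h A Q U : ℕ} (hb : 2 ≤ b) (hh : 1 ≤ h) (hU : 64 ≤ U) (hQ : 1 ≤ Q)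
    (hA : A = Q * U) (irr : Irrational (Real.log b / Real.log A)) :
    ∃ P0 : ℕ, ∀ p ≥ P0, ∀ S : Finset (ℕ × ℕ),
      (∀ z ∈ S, z.2 < z.1 ∧ NearSpec A Q U p ((h:ℤ) * ((b:ℤ) ^ z.1 - (b:ℤ) ^ z.2))) →
      ∑ z ∈ S, (1 : ℝ) / (z.1 : ℝ) ^ 2 ≤ 1000 / U := by
  have hbR : (2:ℝ) ≤ b := by exact_mod_cast hb
  have hUR : (64:ℝ) ≤ U := by exact_mod_cast hU
  have hhR : (1:ℝ) ≤ h := by exact_mod_cast hh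
  have hQR : (1:ℝ) ≤ Q := by exact_mod_cast hQ
  have hARe : (A:ℝ) = Q * U := by rw [hA]; push_cast; ring
  have hAR : (64:ℝ) ≤ A := by rw [hARe]; nlinarith
  have hlb : 0.69 < Real.log b := by
    calc (0.69:ℝ) < Real.log 2 := by linarith [Real.log_two_gt_d9]
      _ ≤ Real.log b := Real.log_le_log (by norm_num) hbR
  have hlU : 1 ≤ Real.log U := by
    have : Real.log 64 ≤ Real.log U := Real.log_le_log (by norm_num) hUR
    have h64 : Real.log 64 = 6 * Real.log 2 := by
      rw [show (64:ℝ) = 2 ^ 6 by norm_num, Real.log_pow]; norm_num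
    linarith [Real.log_two_gt_d9]
  have hlA : Real.log A = Real.log Q + Real.log U := by
    rw [hARe, Real.log_mul (by positivity) (by positivity)]
  have hlQ : 0 ≤ Real.log Q := Real.log_nonneg hQR
  have hlA1 : 1 ≤ Real.log A := by linarith
  have hQA : 1 + Real.log Q ≤ Real.log A := by linarith
  set β : ℝ := Real.log A / Real.log b with hβdef
  have hβ : Irrational β := by
    have := irr.inv
    rwa [inv_div] at this
  have hβpos : 0 < β := by positivity
  have hlamq : ∀ q : ℕ, 1 ≤ q → 0 < 6 / (U * q * Real.log b) ∧ 6 / (U * q * Real.log b) ≤ 1/4 := by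
    intro q hq
    have hqR : (1:ℝ) ≤ q := by exact_mod_cast hq
    refine ⟨by positivity, ?_⟩
    rw [div_le_div_iff₀ (by positivity) (by positivity)]
    have : (64:ℝ) * 1 ≤ U * q := by gcongr
    nlinarith
  have hC : ∀ q : ℕ, ∃ C : ℝ, 0 ≤ C ∧ (1 ≤ q → ∀ (x : ℝ) (p : ℕ) (S : Finset ℕ),
      (∀ i ∈ S, p ≤ i ∧ i < 2 * p ∧ ∃ n : ℤ, x + i * β ≤ n ∧
        (n : ℝ) ≤ x + i * β + 6 / (U * q * Real.log b)) →
      (S.card : ℝ) ≤ 4 * (6 / (U * q * Real.log b)) * p + C) := by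
    intro q
    by_cases hq : 1 ≤ q
    · obtain ⟨C, h0, h1⟩ := arc_count β hβ _ (hlamq q hq).1 (hlamq q hq).2
      exact ⟨C, h0, fun _ => h1⟩
    · exact ⟨0, le_rfl, fun h => absurd h hq⟩
  choose C hC0 hC using hC
  set Ct : ℝ := ∑ q ∈ Finset.Icc 1 Q, C q with hCt
  have hCt0 : 0 ≤ Ct := Finset.sum_nonneg (fun q _ => hC0 q)
  obtain ⟨P0, hP0⟩ := exists_nat_ge ((1 + 2 * Real.log (2 * h) / Real.log b + Ct * U) / β)
  refine ⟨P0, fun p hp S hS => ?_⟩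
  set a : ℝ := p * β with ha
  have hl2h : 0 ≤ Real.log (2 * h) := Real.log_nonneg (by linarith)
  have ha0 : 1 + 2 * Real.log (2 * h) / Real.log b + Ct * U ≤ a := by
    rw [div_le_iff₀ hβpos] at hP0
    have : (P0:ℝ) ≤ p := by exact_mod_cast hp
    have : (P0:ℝ) * β ≤ p * β := by gcongr
    linarith
  have hx1 : 0 ≤ 2 * Real.log (2 * h) / Real.log b := by positivity
  have hx2 : 0 ≤ Ct * U := by positivity
  have ha1 : 1 ≤ a := by linarith
  have hab : a * Real.log b = p * Real.log A := by rw [ha, hβdef]; field_simp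
  -- data for each pair
  have hdata : ∀ z : ℕ × ℕ, ∃ iq : ℕ × ℕ, z ∈ S → p ≤ iq.1 ∧ iq.1 < 2 * p ∧ 1 ≤ iq.2 ∧ iq.2 ≤ Q ∧
      |(h:ℤ) * ((b:ℤ) ^ z.1 - (b:ℤ) ^ z.2) - iq.2 * (A:ℤ) ^ iq.1| * U ≤ 2 * (A:ℤ) ^ iq.1 := by
    intro z
    by_cases hz : z ∈ S
    · obtain ⟨-, i, q, h⟩ := hS z hz
      exact ⟨(i, q), fun _ => h⟩
    · exact ⟨(0,0), fun h => absurd h hz⟩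
  choose f hf using hdata
  have hreal : ∀ z ∈ S,
      Real.log ((f z).2 - 2 / U) ≤ Real.log (h * (1 - 1 / (b:ℝ) ^ (z.1 - z.2))) + z.1 * Real.log b
        - (f z).1 * Real.log A ∧
      Real.log (h * (1 - 1 / (b:ℝ) ^ (z.1 - z.2))) + z.1 * Real.log b - (f z).1 * Real.log A
        ≤ Real.log ((f z).2 + 2 / U) := by
    intro z hz
    have h1 := (hS z hz).1
    have h2 := hf z hz
    refine nearSpec_real hb hh hU hA (f z).1 (f z).2 z.1 (z.1 - z.2) (by omega) (by omega)
      h2.2.2.1 h2.2.2.2.1 ?_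
    rw [show z.1 - (z.1 - z.2) = z.2 by omega]
    exact h2.2.2.2.2
  have hcb : ∀ d : ℕ, 1 ≤ d → - Real.log 2 ≤ Real.log (h * (1 - 1 / (b:ℝ) ^ d)) ∧
      Real.log (h * (1 - 1 / (b:ℝ) ^ d)) ≤ Real.log h := by
    intro d hd
    have hbd : (2:ℝ) ≤ (b:ℝ) ^ d := by
      calc (2:ℝ) ≤ b := hbR
        _ = (b:ℝ)^1 := by simp
        _ ≤ (b:ℝ)^d := pow_le_pow_right₀ (by linarith) hd
    have hinv : 1 / (b:ℝ) ^ d ≤ 1/2 := by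
      rw [div_le_div_iff₀ (by positivity) (by positivity)]; linarith
    have hinv0 : 0 < 1 / (b:ℝ) ^ d := by positivity
    constructor
    · rw [← Real.log_inv]
      apply Real.log_le_log (by norm_num)
      nlinarith
    · apply Real.log_le_log
      · apply mul_pos <;> linarith
      · nlinarith
  have h2U : 2 / (U:ℝ) ≤ 1/32 := by
    rw [div_le_div_iff₀ (by positivity) (by positivity)]; linarith
  have h2U0 : 0 < 2 / (U:ℝ) := by positivity
  have hlb2 : Real.log 2 ≤ Real.log b := Real.log_le_log (by norm_num) hbR
  -- upper and lower bounds of n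
  have hnub : ∀ z ∈ S, (z.1 : ℝ) ≤ 2 * a + 1 := by
    intro z hz
    have h1 := (hS z hz).1
    obtain ⟨g1, g2, g3, g4, -⟩ := hf z hz
    have hc := hcb (z.1 - z.2) (by omega)
    have hr := (hreal z hz).2
    have g4R : ((f z).2 : ℝ) ≤ Q := by exact_mod_cast g4
    have g2R : ((f z).1 : ℝ) + 1 ≤ 2 * p := by exact_mod_cast g2
    have : Real.log ((f z).2 + 2 / U) ≤ Real.log A := by
      apply Real.log_le_log (by positivity)
      rw [hARe]; nlinarith
    have h3 : ((f z).1 + 1) * Real.log A ≤ 2 * p * Real.log A := by gcongr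
    have h4 : z.1 * Real.log b ≤ (2 * a + 1) * Real.log b := by
      have e5 : (2 * a + 1) * Real.log b = 2 * p * Real.log A + Real.log b := by
        linear_combination 2 * hab
      have e6 : (((f z).1:ℝ) + 1) * Real.log A = (f z).1 * Real.log A + Real.log A := by ring
      linarith [hc.1]
    exact le_of_mul_le_mul_right h4 (by linarith)
  have hnlb : ∀ z ∈ S, a / 2 ≤ (z.1 : ℝ) := by
    intro z hz
    have h1 := (hS z hz).1
    obtain ⟨g1, g2, g3, g4, -⟩ := hf z hz
    have hc := hcb (z.1 - z.2) (by omega)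
    have hr := (hreal z hz).1
    have g3R : (1:ℝ) ≤ (f z).2 := by exact_mod_cast g3
    have g1R : (p:ℝ) ≤ (f z).1 := by exact_mod_cast g1
    have : - Real.log 2 ≤ Real.log ((f z).2 - 2 / U) := by
      rw [← Real.log_inv]
      apply Real.log_le_log (by norm_num)
      linarith
    have h3 : p * Real.log A ≤ (f z).1 * Real.log A := by gcongr
    have h5 : Real.log (2 * h) = Real.log 2 + Real.log h :=
      Real.log_mul (by norm_num) (by positivity)
    have h6 : 2 * Real.log (2 * h) / Real.log b ≤ a := by linarith
    rw [div_le_iff₀ (by linarith)] at h6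
    have h4 : a / 2 * Real.log b ≤ z.1 * Real.log b := by
      have e5 : a / 2 * Real.log b = a * Real.log b / 2 := by ring
      linarith [hc.2]
    exact le_of_mul_le_mul_right h4 (by linarith)
  -- counting
  set N : ℕ := ⌊2 * a + 1⌋₊ with hN
  have hNle : (N:ℝ) ≤ 2 * a + 1 := Nat.floor_le (by linarith)
  classical
  let T : ℕ × ℕ → Finset ℕ := fun dq => (S.filter (fun z => z.1 - z.2 = dq.1 ∧ (f z).2 = dq.2)).image
    (fun z => (f z).1)
  have hcard : S.card ≤ ∑ dq ∈ Finset.Icc 1 N ×ˢ Finset.Icc 1 Q, (T dq).card := by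
    rw [← Finset.card_sigma]
    apply Finset.card_le_card_of_injOn
      (fun z => (⟨(z.1 - z.2, (f z).2), (f z).1⟩ : Σ _ : ℕ × ℕ, ℕ))
    · intro z hz
      have hz' : z ∈ S := hz
      have h1 := (hS z hz').1
      obtain ⟨g1, g2, g3, g4, -⟩ := hf z hz'
      have : z.1 ≤ N := Nat.le_floor (hnub z hz')
      simp only [coe_sigma, Set.mem_sigma_iff, mem_coe, mem_product, Finset.mem_Icc]
      refine ⟨⟨⟨by omega, by omega⟩, g3, g4⟩, ?_⟩
      simp only [T, mem_image, mem_filter]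
      exact ⟨z, ⟨hz', rfl, rfl⟩, rfl⟩
    · intro z hz w hw heq
      have hz' : z ∈ S := hz
      have hw' : w ∈ S := hw
      simp only [Sigma.mk.injEq, Prod.mk.injEq, heq_eq_eq] at heq
      obtain ⟨⟨e1, e2⟩, e3⟩ := heq
      have hr1 := hreal z hz'
      have hr2 := hreal w hw'
      rw [e1, e2, e3] at hr1
      obtain ⟨g1, g2, g3, g4, -⟩ := hf w hw'
      have g3R : (1:ℝ) ≤ (f w).2 := by exact_mod_cast g3
      have hlt : Real.log ((f w).2 + 2 / U) < Real.log ((f w).2 - 2 / U) + Real.log b := by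
        rw [← Real.log_mul (by linarith) (by linarith)]
        apply Real.log_lt_log (by positivity)
        nlinarith
      have k1 : (z.1:ℝ) < w.1 + 1 := by
        have : z.1 * Real.log b < (w.1 + 1) * Real.log b := by
          rw [add_mul, one_mul]; linarith [hr1.1, hr1.2, hr2.1, hr2.2]
        exact lt_of_mul_lt_mul_right this (by linarith)
      have k2 : (w.1:ℝ) < z.1 + 1 := by
        have : w.1 * Real.log b < (z.1 + 1) * Real.log b := by
          rw [add_mul, one_mul]; linarith [hr1.1, hr1.2, hr2.1, hr2.2]
        exact lt_of_mul_lt_mul_right this (by linarith)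
      have k1' : z.1 < w.1 + 1 := by exact_mod_cast k1
      have k2' : w.1 < z.1 + 1 := by exact_mod_cast k2
      have h1 := (hS z hz').1
      have h2 := (hS w hw').1
      ext <;> omega
  have hT : ∀ dq ∈ Finset.Icc 1 N ×ˢ Finset.Icc 1 Q,
      ((T dq).card : ℝ) ≤ 4 * (6 / (U * dq.2 * Real.log b)) * p + C dq.2 := by
    rintro ⟨d, q⟩ hdq
    simp only [mem_product, Finset.mem_Icc] at hdq
    have hqR : (1:ℝ) ≤ q := by exact_mod_cast hdq.2.1
    apply hC q hdq.2.1
      ((Real.log (q - 2 / U) - Real.log (h * (1 - 1 / (b:ℝ) ^ d))) / Real.log b) p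
    intro i hi
    simp only [T, mem_image, mem_filter] at hi
    obtain ⟨z, ⟨hz, e1, e2⟩, e3⟩ := hi
    obtain ⟨g1, g2, g3, g4, -⟩ := hf z hz
    have hr := hreal z hz
    rw [e1, e2, e3] at hr
    refine ⟨by omega, by omega, z.1, ?_⟩
    have hlbpos : 0 < Real.log b := by linarith
    have hib : (i:ℝ) * β = i * Real.log A / Real.log b := by rw [hβdef]; ring
    have hgap : Real.log (q + 2 / U) ≤ Real.log (q - 2 / U) + 6 / (U * q) := by
      have e : Real.log (q + 2 / U) - Real.log (q - 2 / U)
          = Real.log ((q + 2 / U) / (q - 2 / U)) := by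
        rw [Real.log_div (by positivity) (by linarith)]
      have l1 : Real.log ((q + 2 / U) / (q - 2 / U)) ≤ (q + 2 / U) / (q - 2 / U) - 1 :=
        Real.log_le_sub_one_of_pos (div_pos (by positivity) (by linarith))
      have l2 : (q + 2 / (U:ℝ)) / (q - 2 / U) - 1 = (4 / U) / (q - 2 / U) := by
        have : (q:ℝ) - 2 / U ≠ 0 := by linarith
        rw [div_sub_one this]; ring
      have l3 : (4 / (U:ℝ)) / (q - 2 / U) ≤ 6 / (U * q) := by
        rw [div_le_div_iff₀ (by linarith) (by positivity)]
        have e4 : 4 / (U:ℝ) * (U * q) = 4 * q := by field_simp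
        rw [e4]; nlinarith
      linarith
    rw [hib, ← add_div, ← div_div, ← add_div]
    constructor
    · rw [div_le_iff₀ hlbpos]; push_cast; linarith
    · rw [le_div_iff₀ hlbpos]; push_cast; linarith
  have hharm : ∑ q ∈ Finset.Icc 1 Q, (4 * (6 / (U * q * Real.log b)) * p + C q)
      ≤ 24 * a / U + Ct := by
    rw [Finset.sum_add_distrib]
    have e : ∑ q ∈ Finset.Icc 1 Q, (4 * (6 / (U * q * Real.log b)) * p : ℝ)
        = 24 * p / (U * Real.log b) * ∑ q ∈ Finset.Icc 1 Q, (q:ℝ)⁻¹ := by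
      rw [Finset.mul_sum]
      apply Finset.sum_congr rfl
      intro q hq
      have : (1:ℝ) ≤ q := by exact_mod_cast (Finset.mem_Icc.1 hq).1
      field_simp; ring
    have e2 : ∑ q ∈ Finset.Icc 1 Q, (q:ℝ)⁻¹ ≤ 1 + Real.log Q := by
      have := harmonic_le_one_add_log Q
      rw [harmonic_eq_sum_Icc] at this
      push_cast at this
      exact this
    rw [e]
    have e3 : 24 * p / (U * Real.log b) * ∑ q ∈ Finset.Icc 1 Q, (q:ℝ)⁻¹
        ≤ 24 * p / (U * Real.log b) * Real.log A := by
      gcongr; linarith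
    have e4 : 24 * p / (U * Real.log b) * Real.log A = 24 * a / U := by
      rw [ha, hβdef]; field_simp
    linarith
  have hcardR : (S.card : ℝ) ≤ (2 * a + 1) * (24 * a / U + Ct) := by
    have h1 : (S.card : ℝ) ≤ ∑ dq ∈ Finset.Icc 1 N ×ˢ Finset.Icc 1 Q, ((T dq).card : ℝ) := by
      exact_mod_cast hcard
    have h2 := h1.trans (Finset.sum_le_sum hT)
    rw [Finset.sum_product] at h2
    simp only [Finset.sum_const, Nat.card_Icc, nsmul_eq_mul] at h2
    have h3 : ((N + 1 - 1 : ℕ) : ℝ) = N := by simp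
    rw [h3] at h2
    refine h2.trans ?_
    have h24 : 0 ≤ 24 * a / U + Ct := by positivity
    calc _ ≤ (N:ℝ) * (24 * a / U + Ct) := by gcongr
      _ ≤ _ := by gcongr
  have hterm : ∀ z ∈ S, (1:ℝ) / (z.1:ℝ) ^ 2 ≤ 4 / a ^ 2 := by
    intro z hz
    have := hnlb z hz
    have hz0 : 0 < (z.1:ℝ) := by linarith
    rw [div_le_div_iff₀ (by positivity) (by positivity)]
    nlinarith
  calc ∑ z ∈ S, (1:ℝ) / (z.1:ℝ) ^ 2 ≤ ∑ z ∈ S, 4 / a ^ 2 := Finset.sum_le_sum hterm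
    _ = S.card * (4 / a ^ 2) := by simp
    _ ≤ ((2 * a + 1) * (24 * a / U + Ct)) * (4 / a ^ 2) := by gcongr
    _ ≤ ((3 * a) * (24 * a / U + a / U)) * (4 / a ^ 2) := by
        have : Ct ≤ a / U := by
          rw [le_div_iff₀ (by positivity)]; linarith
        gcongr
        linarith
    _ = 300 / U := by field_simp; ring
    _ ≤ 1000 / U := by gcongr; norm_num


lemma del_det (z : ℕ → ℂ) (hz : ∀ n, ‖z n‖ ≤ 1)
    (hs : Summable (fun N : ℕ => ‖∑ n ∈ range N, z n‖ ^ 2 / (N:ℝ) ^ 3)) :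
    Tendsto (fun N : ℕ => (∑ n ∈ range N, z n) / (N:ℂ)) atTop (nhds 0) := by
  set S : ℕ → ℂ := fun N => ∑ n ∈ range N, z n with hS
  have hlip : ∀ N k, ‖S N‖ ≤ ‖S (N + k)‖ + k := by
    intro N k
    induction k with
    | zero => simp
    | succ k ih =>
      have h1 : S (N + k) = S (N + (k+1)) - z (N + k) := by
        simp only [hS, ← add_assoc, sum_range_succ]; ring
      have h2 : ‖S (N + k)‖ ≤ ‖S (N + (k+1))‖ + ‖z (N+k)‖ := by rw [h1]; exact norm_sub_le _ _
      have := hz (N + k)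
      push_cast; linarith
  have hle : ∀ N, ‖S N‖ ≤ N := by
    intro N
    calc ‖S N‖ ≤ ∑ n ∈ range N, ‖z n‖ := norm_sum_le _ _
      _ ≤ ∑ n ∈ range N, (1:ℝ) := sum_le_sum fun n _ => hz n
      _ = N := by simp
  rw [Metric.tendsto_atTop]
  intro ε hε
  have ht := tendsto_sum_nat_add (fun N : ℕ => ‖S N‖ ^ 2 / (N:ℝ) ^ 3)
  have hev := (ht.eventually (gt_mem_nhds (show (0:ℝ) < ε ^ 3 / 64 by positivity)))
  obtain ⟨N0, hN0⟩ := (hev.and (eventually_ge_atTop 1)).exists_forall_of_atTop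
  refine ⟨N0, fun N hN => ?_⟩
  obtain ⟨h1, h2⟩ := hN0 N hN
  rw [dist_zero_right, norm_div, Complex.norm_natCast]
  have hNpos : (0:ℝ) < N := by exact_mod_cast h2
  rw [div_lt_iff₀ hNpos]
  by_contra hcon
  push Not at hcon
  have hε1 : ε ≤ 1 := by
    have := hle N
    by_contra h; push Not at h
    nlinarith
  have hsum : ∑ k ∈ range (⌊ε * N / 2⌋₊ + 1), ‖S (k + N)‖ ^ 2 / ((k + N : ℕ):ℝ) ^ 3
      ≤ ∑' k, ‖S (k + N)‖ ^ 2 / ((k + N : ℕ):ℝ) ^ 3 := by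
    apply Summable.sum_le_tsum
    · intros; positivity
    · exact (summable_nat_add_iff N).2 hs
  have hterm : ∀ k ∈ range (⌊ε * N / 2⌋₊ + 1),
      ε ^ 2 / (32 * N) ≤ ‖S (k + N)‖ ^ 2 / ((k + N : ℕ):ℝ) ^ 3 := by
    intro k hk
    have hk1 : k ≤ ⌊ε * N / 2⌋₊ := by
      have := mem_range.1 hk; omega
    have hk2 : (k:ℝ) ≤ ε * N / 2 := (Nat.le_floor_iff (by positivity)).1 hk1
    have h3 := hlip N k
    rw [add_comm N k] at h3
    have h4 : ε * N / 2 ≤ ‖S (k + N)‖ := by linarith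
    have h5 : ((k + N : ℕ):ℝ) ≤ 2 * N := by push_cast; nlinarith
    calc ε ^ 2 / (32 * N) = (ε * N / 2) ^ 2 / (2 * N) ^ 3 := by field_simp; ring
      _ ≤ ‖S (k + N)‖ ^ 2 / ((k + N : ℕ):ℝ) ^ 3 := by gcongr
  have := sum_le_sum hterm
  simp only [sum_const, card_range, nsmul_eq_mul] at this
  have hfl : ε * N / 2 < ((⌊ε * N / 2⌋₊ + 1 : ℕ) : ℝ) := by
    push_cast; exact Nat.lt_floor_add_one _
  have h6 : ε ^ 3 / 64 ≤ ((⌊ε * N / 2⌋₊ + 1 : ℕ) : ℝ) * (ε ^ 2 / (32 * N)) := by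
    calc ε ^ 3 / 64 = (ε * N / 2) * (ε ^ 2 / (32 * N)) := by field_simp; ring
      _ ≤ _ := by gcongr
  linarith

lemma eneg_norm (y : ℝ) : ‖eneg y‖ = 1 := by
  unfold eneg
  rw [show -(2 * (Real.pi:ℂ) * Complex.I * (y:ℂ)) = ((-(2 * Real.pi * y) : ℝ) : ℂ) * Complex.I by
    push_cast; ring]
  exact Complex.norm_exp_ofReal_mul_I _

lemma eneg_add (x y : ℝ) : eneg (x + y) = eneg x * eneg y := by
  unfold eneg; rw [← Complex.exp_add]; congr 1; push_cast; ring

lemma eneg_conj (y : ℝ) : (starRingEnd ℂ) (eneg y) = eneg (-y) := by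
  unfold eneg; rw [← Complex.exp_conj]; congr 1
  simp [Complex.conj_ofReal]
  left; exact map_ofNat _ 2

lemma eneg_cont : Continuous eneg := by unfold eneg; fun_prop

lemma eneg_int (n : ℤ) : eneg n = 1 := by
  unfold eneg
  rw [Complex.exp_eq_one_iff]
  exact ⟨-n, by push_cast; ring⟩

lemma eneg_add_int (y : ℝ) (n : ℤ) : eneg (y + n) = eneg y := by
  rw [eneg_add, eneg_int, mul_one]

lemma eneg_sub_int (y : ℝ) (n : ℤ) : eneg (y - n) = eneg y := by
  have := eneg_add_int (y - n) n
  rw [sub_add_cancel] at this; exact this.symm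

lemma weight_sum (w : ℕ → ℝ) (hw : ∀ n, 0 ≤ w n) (hw0 : w 0 = 0) (M : ℕ) :
    ∑ N ∈ range (M+1), (∑ n ∈ range N, w n) / (N:ℝ)^3 + (∑ n ∈ range (M+1), w n) / (M:ℝ)^2
      ≤ ∑ n ∈ range (M+1), w n / (n:ℝ)^2 := by
  induction M with
  | zero => simp [hw0]
  | succ M ih =>
    rw [sum_range_succ _ (M+1), sum_range_succ (fun n => w n / (n:ℝ)^2) (M+1),
      sum_range_succ w (M+1)]
    set W := ∑ n ∈ range (M+1), w n with hW
    have hW0 : 0 ≤ W := sum_nonneg fun n _ => hw n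
    have key : W / ((M+1:ℕ):ℝ)^3 + W / ((M+1:ℕ):ℝ)^2 ≤ W / (M:ℝ)^2 := by
      rcases Nat.eq_zero_or_pos M with h | h
      · subst h; simp [hW, hw0]
      · have hM : (0:ℝ) < M := by exact_mod_cast h
        have : 1 / ((M:ℝ)+1)^3 + 1 / ((M:ℝ)+1)^2 ≤ 1 / (M:ℝ)^2 := by
          rw [div_add_div _ _ (by positivity) (by positivity), div_le_div_iff₀ (by positivity) (by positivity)]
          nlinarith [pow_pos hM 2, pow_pos hM 3, pow_pos hM 4]
        push_cast
        calc _ = W * (1 / ((M:ℝ)+1)^3 + 1 / ((M:ℝ)+1)^2) := by ring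
          _ ≤ W * (1 / (M:ℝ)^2) := by gcongr
          _ = _ := by ring
    rw [add_div]
    linarith

lemma weyl_ae (μ : Measure ℝ) [IsProbabilityMeasure μ] (h b : ℕ) (C : ℝ)
    (hC : ∀ S : Finset (ℕ × ℕ), (∀ z ∈ S, z.2 < z.1) →
      ∑ z ∈ S, ‖muHat μ ((h:ℤ) * ((b:ℤ)^z.1 - (b:ℤ)^z.2))‖ / (z.1:ℝ)^2 ≤ C) :
    ∀ᵐ x ∂μ, Tendsto (fun N : ℕ => (∑ n ∈ range N, eneg (h * (b:ℝ)^n * x)) / (N:ℂ)) atTop (nhds 0) := by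
  set z : ℕ → ℝ → ℂ := fun n x => eneg (h * (b:ℝ)^n * x) with hz
  set S : ℕ → ℝ → ℂ := fun N x => ∑ n ∈ range N, z n x with hS
  have hzc : ∀ n, Continuous (z n) := fun n => eneg_cont.comp (by fun_prop)
  have hSc : ∀ n, Continuous (S n) := fun n => continuous_finsetSum _ fun i _ => hzc i
  have hzn : ∀ n x, ‖z n x‖ = 1 := fun n x => eneg_norm _
  have hSn : ∀ N x, ‖S N x‖ ≤ N := by
    intro N x
    calc ‖S N x‖ ≤ ∑ n ∈ range N, ‖z n x‖ := norm_sum_le _ _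
      _ = N := by simp [hzn]
  have h_integrable_aux : ∀ f : ℝ → ℂ, Continuous f → (∃ K : ℝ, ∀ x, ‖f x‖ ≤ K) → Integrable f μ := by
    rintro f hf ⟨K, hK⟩
    exact Integrable.of_bound hf.aestronglyMeasurable K (Eventually.of_forall hK)
  have hintR : ∀ f : ℝ → ℝ, Continuous f → (∃ K : ℝ, ∀ x, ‖f x‖ ≤ K) → Integrable f μ := by
    rintro f hf ⟨K, hK⟩
    exact Integrable.of_bound hf.aestronglyMeasurable K (Eventually.of_forall hK)
  have hIS : ∀ N, Integrable (fun x => ‖S N x‖^2) μ := by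
    intro N
    refine hintR _ ((hSc N).norm.pow 2) ⟨N^2, fun x => ?_⟩
    rw [norm_pow, norm_norm]
    gcongr; exact hSn N x
  set w : ℕ → ℝ := fun n => ∑ m ∈ range n, ‖muHat μ ((h:ℤ) * ((b:ℤ)^n - (b:ℤ)^m))‖ with hw
  have hE : ∀ N, ∫ x, ‖S N x‖^2 ∂μ ≤ N + 2 * ∑ n ∈ range N, w n := by
    intro N
    induction N with
    | zero => simp [hS]
    | succ N ih =>
      have e1 : ∀ x, ‖S (N+1) x‖^2 = ‖S N x‖^2 + 1 + 2 * (z N x * (starRingEnd ℂ) (S N x)).re := by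
        intro x
        have : S (N+1) x = z N x + S N x := by simp only [hS, sum_range_succ]; ring
        rw [this, ← Complex.normSq_eq_norm_sq, Complex.normSq_add, Complex.normSq_eq_norm_sq,
          Complex.normSq_eq_norm_sq, hzn]; ring
      have e2 : ∀ x, z N x * (starRingEnd ℂ) (S N x) =
          ∑ m ∈ range N, eneg (((((h:ℤ) * ((b:ℤ)^N - (b:ℤ)^m)) : ℤ) : ℝ) * x) := by
        intro x
        simp only [hS, map_sum, mul_sum, hz, eneg_conj]
        apply sum_congr rfl
        intro m _
        rw [← eneg_add]; congr 1; push_cast; ring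
      have hi : ∀ m : ℕ, Integrable (fun x : ℝ => eneg (((((h:ℤ) * ((b:ℤ)^N - (b:ℤ)^m)) : ℤ) : ℝ) * x)) μ :=
        fun m => h_integrable_aux _ (eneg_cont.comp (by fun_prop)) ⟨1, fun x => (eneg_norm _).le⟩
      have hi2 : Integrable (fun x => z N x * (starRingEnd ℂ) (S N x)) μ := by
        simp_rw [e2]; exact integrable_finsetSum _ fun m _ => hi m
      have e3 : ∫ x, (z N x * (starRingEnd ℂ) (S N x)).re ∂μ ≤ w N := by
        have : ∫ x, (z N x * (starRingEnd ℂ) (S N x)).re ∂μ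
            = (∫ x, (z N x * (starRingEnd ℂ) (S N x)) ∂μ).re := integral_re hi2
        rw [this]
        refine (Complex.re_le_norm _).trans ?_
        simp_rw [e2]
        rw [integral_finsetSum _ fun m _ => hi m]
        exact norm_sum_le _ _
      simp_rw [e1]
      rw [integral_add, integral_add, integral_const_mul, sum_range_succ]
      · simp only [integral_const, probReal_univ, smul_eq_mul, mul_one]
        push_cast; linarith
      · exact hIS N
      · exact integrable_const _
      · exact (hIS N).add (integrable_const _)
      · exact (hi2.re).const_mul 2
  have hwn : ∀ n, 0 ≤ w n := fun n => sum_nonneg fun m _ => norm_nonneg _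
  have hwC : ∀ M, ∑ n ∈ range M, w n / (n:ℝ)^2 ≤ C := by
    intro M
    have := hC ((range M).sigma (fun n => range n) |>.map
      ⟨fun p => (p.1, p.2), fun p q hpq => by
        simp only [Prod.mk.injEq] at hpq; exact Sigma.ext hpq.1 (heq_of_eq hpq.2)⟩) (by
        intro z hz
        simp only [Finset.mem_map, mem_sigma, mem_range, Function.Embedding.coeFn_mk] at hz
        obtain ⟨a, ⟨_, h2⟩, rfl⟩ := hz
        exact h2)
    rw [sum_map, sum_sigma] at this
    refine le_trans (le_of_eq ?_) this
    apply sum_congr rfl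
    intro n _
    rw [hw, sum_div]; rfl
  have hsummable : Summable (fun N : ℕ => ∫ x, ‖S N x‖^2 / (N:ℝ)^3 ∂μ) := by
    have hs2 : Summable (fun N : ℕ => 1 / (N:ℝ)^2) := Real.summable_one_div_nat_pow.2 (by norm_num)
    have hs3 : Summable (fun N : ℕ => 2 * ((∑ n ∈ range N, w n) / (N:ℝ)^3)) := by
      apply Summable.mul_left
      apply summable_of_sum_range_le (c := C)
      · intro n; exact div_nonneg (sum_nonneg fun n _ => hwn n) (by positivity)
      · intro M
        have h1 := weight_sum w hwn (by simp [hw]) M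
        have h2 : 0 ≤ (∑ n ∈ range (M+1), w n) / (M:ℝ)^2 :=
          div_nonneg (sum_nonneg fun n _ => hwn n) (by positivity)
        have h3 := hwC (M+1)
        rw [sum_range_succ] at h1
        have h4 : 0 ≤ (∑ n ∈ range M, w n) / (M:ℝ)^3 :=
          div_nonneg (sum_nonneg fun n _ => hwn n) (by positivity)
        linarith
    refine Summable.of_nonneg_of_le (fun N => integral_nonneg fun x => by positivity) (fun N => ?_)
      (hs2.add hs3)
    rw [integral_div]
    rcases Nat.eq_zero_or_pos N with h0 | h0
    · subst h0; simp
    · have hN : (0:ℝ) < N := by exact_mod_cast h0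
      calc _ ≤ (N + 2 * ∑ n ∈ range N, w n) / (N:ℝ)^3 := by gcongr; exact hE N
        _ = _ := by field_simp
  have hfin : ∫⁻ x, ∑' N : ℕ, ENNReal.ofReal (‖S N x‖^2 / (N:ℝ)^3) ∂μ ≠ ⊤ := by
    rw [lintegral_tsum]
    · have : ∀ N : ℕ, ∫⁻ x, ENNReal.ofReal (‖S N x‖^2 / (N:ℝ)^3) ∂μ
          = ENNReal.ofReal (∫ x, ‖S N x‖^2 / (N:ℝ)^3 ∂μ) := by
        intro N
        rw [ofReal_integral_eq_lintegral_ofReal ((hIS N).div_const _)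
          (Eventually.of_forall fun x => by positivity)]
      simp_rw [this]
      exact hsummable.tsum_ofReal_ne_top
    · intro N
      have hc : Continuous (fun x => ‖S N x‖^2 / (N:ℝ)^3) := ((hSc N).norm.pow 2).div_const _
      exact hc.measurable.ennreal_ofReal.aemeasurable
  have hae := ae_lt_top' (by
    apply AEMeasurable.ennreal_tsum
    intro N
    have hc : Continuous (fun x => ‖S N x‖^2 / (N:ℝ)^3) := ((hSc N).norm.pow 2).div_const _
    exact hc.measurable.ennreal_ofReal.aemeasurable) hfin
  filter_upwards [hae] with x hx
  apply del_det (fun n => z n x) (fun n => (hzn n x).le)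
  have h1 := ENNReal.summable_toReal hx.ne
  refine h1.congr fun N => ?_
  rw [ENNReal.toReal_ofReal (by positivity)]


/-- Value of a digit block. -/
def blockVal (b : ℕ) (d : ℕ → ℕ) : ℕ → ℕ
  | 0 => 0
  | k + 1 => blockVal b d k * b + d k

lemma block_iff (b : ℕ) (hb : 2 ≤ b) (a : ℕ → ℕ) (ha : ∀ j, a j = a (j+1) / b)
    (d : ℕ → ℕ) (hd : ∀ i, d i < b) (n k : ℕ) :
    (∀ i < k, a (n + 1 + i) % b = d i) ↔ a (n + k) % b ^ k = blockVal b d k := by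
  induction k with
  | zero => simp [blockVal, Nat.mod_one]
  | succ k ih =>
    have h1 : a (n + (k+1)) % b ^ (k+1) = b * (a (n + k) % b ^ k) + a (n + (k + 1)) % b := by
      rw [pow_succ', Nat.mod_mul, ha (n + k), add_comm]; rfl
    have h2 : (∀ i < k + 1, a (n + 1 + i) % b = d i) ↔
        (∀ i < k, a (n + 1 + i) % b = d i) ∧ a (n + 1 + k) % b = d k := by
      constructor
      · intro h; exact ⟨fun i hi => h i (by omega), h k (by omega)⟩
      · rintro ⟨h, h'⟩ i hi
        rcases Nat.lt_succ_iff_lt_or_eq.1 hi with hi | rfl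
        · exact h i hi
        · exact h'
    rw [h2, ih, h1, blockVal, show n + 1 + k = n + (k+1) by ring]
    constructor
    · rintro ⟨e1, e2⟩; rw [e1, e2]; ring
    · intro e
      have l1 : a (n + (k+1)) % b < b := Nat.mod_lt _ (by omega)
      have l2 := hd k
      have e3 : (b * (a (n + k) % b ^ k) + a (n + (k + 1)) % b) % b = (blockVal b d k * b + d k) % b := by rw [e]
      have e4 : (b * (a (n + k) % b ^ k) + a (n + (k + 1)) % b) / b = (blockVal b d k * b + d k) / b := by rw [e]
      rw [Nat.mul_add_mod, Nat.mul_add_mod', Nat.mod_eq_of_lt l1, Nat.mod_eq_of_lt l2] at e3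
      rw [Nat.mul_add_div (by omega), mul_comm, Nat.mul_add_div (by omega), Nat.div_eq_of_lt l1,
        Nat.div_eq_of_lt l2] at e4
      exact ⟨by simpa using e4, e3⟩

lemma blockVal_lt (b : ℕ) (d : ℕ → ℕ) (hd : ∀ i, d i < b) (k : ℕ) : blockVal b d k < b ^ k := by
  induction k with
  | zero => simp [blockVal]
  | succ k ih => rw [blockVal, pow_succ]; nlinarith [hd k]

lemma floor_block (b : ℕ) (hb : 2 ≤ b) (x : ℝ) (n k : ℕ) :
    ⌊Int.fract x * (b:ℝ)^(n+k)⌋₊ % b^k = ⌊(b:ℝ)^k * Int.fract ((b:ℝ)^n * x)⌋₊ := by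
  set t := Int.fract x with ht
  have ht0 : 0 ≤ t := Int.fract_nonneg x
  have hbR : (0:ℝ) < b := by positivity
  have h1 : Int.fract ((b:ℝ)^n * x) = Int.fract ((b:ℝ)^n * t) := by
    rw [Int.fract_eq_fract]
    refine ⟨(b:ℤ)^n * ⌊x⌋, ?_⟩
    have := Int.floor_add_fract x
    push_cast
    rw [ht]
    linear_combination (-(b:ℝ)^n) * this
  rw [h1]
  set f := Int.fract ((b:ℝ)^n * t) with hf
  have hf0 : 0 ≤ f := Int.fract_nonneg _
  have hf1 : f < 1 := Int.fract_lt_one _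
  have h2 : (b:ℝ)^n * t = (⌊(b:ℝ)^n * t⌋₊ : ℝ) + f := by
    rw [hf, natCast_floor_eq_intCast_floor (by positivity), Int.floor_add_fract]
  have h3 : t * (b:ℝ)^(n+k) = (b:ℝ)^k * f + ((⌊(b:ℝ)^n * t⌋₊ * b^k : ℕ) : ℝ) := by
    push_cast; rw [pow_add]; linear_combination (b:ℝ)^k * h2
  rw [h3, Nat.floor_add_natCast (by positivity), Nat.add_mul_mod_self_right, Nat.mod_eq_of_lt]
  rw [Nat.floor_lt (by positivity)]
  push_cast
  nlinarith [pow_pos hbR k]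

lemma isNormal_iff (b : ℕ) (hb : 2 ≤ b) (x : ℝ) :
    IsNormal b x ↔ ∀ k : ℕ, 1 ≤ k → ∀ D < b^k, Tendsto (fun N : ℕ =>
      (((range N).filter fun n => ⌊(b:ℝ)^k * Int.fract ((b:ℝ)^n * x)⌋₊ = D).card : ℝ) / N)
      atTop (nhds (1 / (b : ℝ) ^ k)) := by
  have hbR : (0:ℝ) < b := by positivity
  have ha : ∀ j, ⌊Int.fract x * (b:ℝ)^j⌋₊ = ⌊Int.fract x * (b:ℝ)^(j+1)⌋₊ / b := by
    intro j
    rw [← Nat.floor_div_natCast]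
    congr 1
    rw [pow_succ]; field_simp
  have key : ∀ (k : ℕ) (d : ℕ → ℕ), (∀ i, d i < b) → ∀ N : ℕ,
      ((Finset.Icc 1 N).filter fun n => ∀ i : Fin k, digit b x (n + (i : ℕ)) = d i).card
      = ((range N).filter fun n => ⌊(b:ℝ)^k * Int.fract ((b:ℝ)^n * x)⌋₊ = blockVal b d k).card := by
    intro k d hd N
    symm
    apply Finset.card_bij (fun n _ => n + 1)
    · intro n hn
      simp only [Finset.mem_filter, Finset.mem_range, Finset.mem_Icc] at hn ⊢
      refine ⟨by omega, fun i => ?_⟩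
      rw [← floor_block b hb x n k] at hn
      exact (block_iff b hb (fun j => ⌊Int.fract x * (b:ℝ)^j⌋₊) ha d hd n k).2 hn.2 i i.2
    · intro a _ c _ h; omega
    · intro n hn
      simp only [Finset.mem_filter, Finset.mem_range, Finset.mem_Icc] at hn
      obtain ⟨⟨h1, h2⟩, h3⟩ := hn
      obtain ⟨m, rfl⟩ : ∃ m, n = m + 1 := ⟨n - 1, by omega⟩
      refine ⟨m, ?_, rfl⟩
      simp only [Finset.mem_filter, Finset.mem_range]
      refine ⟨by omega, ?_⟩
      rw [← floor_block b hb x m k]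
      exact (block_iff b hb (fun j => ⌊Int.fract x * (b:ℝ)^j⌋₊) ha d hd m k).1
        (fun i hi => h3 ⟨i, hi⟩)
  constructor
  · intro h k hk D hD
    obtain ⟨d, hd, hdD⟩ : ∃ d : ℕ → ℕ, (∀ i, d i < b) ∧ blockVal b d k = D := by
      refine ⟨fun i => (D * b^(0 + 1+i) / b^k) % b, fun i => Nat.mod_lt _ (by omega), ?_⟩
      rw [← (block_iff b hb (fun j => D * b^j / b^k) (fun j => ?_) _
        (fun i => Nat.mod_lt _ (by omega)) 0 k).1 (fun i hi => rfl)]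
      · simp only [zero_add]
        rw [Nat.mul_div_cancel _ (by positivity), Nat.mod_eq_of_lt hD]
      · rw [Nat.div_div_eq_div_mul, pow_succ, ← mul_assoc, Nat.mul_div_mul_right _ _ (by omega)]
    have := h k hk (fun i => d i) (fun i => hd i)
    subst hdD
    refine this.congr fun N => ?_
    rw [key k d hd N]
  · intro h k hk d hd
    set d' : ℕ → ℕ := fun i => if hi : i < k then d ⟨i, hi⟩ else 0 with hd'
    have hd2 : ∀ i, d' i < b := by
      intro i; simp only [hd']; split_ifs
      · exact hd _
      · omega
    have := h k hk (blockVal b d' k) (blockVal_lt b d' hd2 k)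
    refine this.congr fun N => ?_
    rw [← key k d' hd2 N]
    have : ∀ i : Fin k, d' i = d i := fun i => by simp [hd']
    simp_rw [this]

lemma eneg_lip (x y : ℝ) : ‖eneg x - eneg y‖ ≤ 2 * Real.pi * |x - y| := by
  have e : ∀ y : ℝ, eneg y = Complex.exp (Complex.I * ((-(2 * Real.pi * y) : ℝ) : ℂ)) := by
    intro y; unfold eneg; congr 1; push_cast; ring
  have h1 : eneg x - eneg y = eneg y * (eneg (x - y) - 1) := by
    rw [mul_sub, ← eneg_add, mul_one]; congr 2; ring
  rw [h1, norm_mul, eneg_norm, one_mul, e]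
  refine (Real.norm_exp_I_mul_ofReal_sub_one_le).trans ?_
  rw [Real.norm_eq_abs, abs_neg, abs_mul, abs_of_pos (by positivity)]

lemma eneg_roots (M : ℕ) (hM : 2 ≤ M) : ∑ D ∈ range M, eneg ((D:ℝ) / M) = 0 := by
  have hp := (Complex.isPrimitiveRoot_exp M (by omega)).inv
  have h := hp.geom_sum_eq_zero (by omega)
  rw [← h]
  apply sum_congr rfl
  intro D _
  unfold eneg
  rw [← Complex.exp_neg, ← Complex.exp_nat_mul]
  congr 1
  push_cast
  ring

lemma normal_weyl (b : ℕ) (hb : 2 ≤ b) (x : ℝ) (h : IsNormal b x) :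
    Tendsto (fun N : ℕ => (∑ n ∈ range N, eneg ((b:ℝ)^n * x)) / (N:ℂ)) atTop (nhds 0) := by
  rw [isNormal_iff b hb] at h
  have hbR : (2:ℝ) ≤ b := by exact_mod_cast hb
  rw [Metric.tendsto_atTop]
  intro ε hε
  obtain ⟨k0, hk0⟩ := exists_nat_gt (4 * Real.pi / ε)
  set k := k0 + 1 with hk
  have hbk : (k:ℝ) ≤ (b:ℝ)^k := by
    have : k < b^k := Nat.lt_pow_self (by omega)
    exact_mod_cast this.le
  have hkb : 2 * Real.pi / (b:ℝ)^k < ε / 2 := by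
    rw [div_lt_div_iff₀ (by positivity) (by norm_num)]
    rw [div_lt_iff₀ hε] at hk0
    have : (k0:ℝ) ≤ (b:ℝ)^k := le_trans (by rw [hk]; push_cast; linarith) hbk
    nlinarith
  have hM : 2 ≤ b^k := by
    calc 2 ≤ b := hb
      _ = b^1 := by simp
      _ ≤ b^k := Nat.pow_le_pow_right (by omega) (by omega)
  have hlim : Tendsto (fun N : ℕ => ∑ D ∈ range (b^k),
      (((((range N).filter fun n => ⌊(b:ℝ)^k * Int.fract ((b:ℝ)^n * x)⌋₊ = D).card : ℝ) / N : ℝ) : ℂ)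
        * eneg ((D:ℝ) / ((b^k : ℕ) : ℝ))) atTop (nhds (∑ D ∈ range (b^k), ((1 / (b:ℝ)^k : ℝ) : ℂ) * eneg ((D:ℝ) / ((b^k : ℕ):ℝ)))) := by
    apply tendsto_finsetSum
    intro D hD
    have := h k (by omega) D (mem_range.1 hD)
    exact ((Complex.continuous_ofReal.tendsto _).comp this).mul_const _
  rw [← mul_sum, eneg_roots _ hM, mul_zero] at hlim
  obtain ⟨N0, hN0⟩ := (Metric.tendsto_atTop.1 hlim) (ε/2) (by positivity)
  refine ⟨N0 + 1, fun N hN => ?_⟩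
  have h1 := hN0 N (by omega)
  rw [dist_zero_right] at h1 ⊢
  have hNpos : (0:ℝ) < N := by exact_mod_cast (by omega : 0 < N)
  have hfib : ∑ D ∈ range (b^k),
      (((((range N).filter fun n => ⌊(b:ℝ)^k * Int.fract ((b:ℝ)^n * x)⌋₊ = D).card : ℝ) / N : ℝ) : ℂ)
        * eneg ((D:ℝ) / ((b^k : ℕ) : ℝ))
      = (∑ n ∈ range N, eneg ((⌊(b:ℝ)^k * Int.fract ((b:ℝ)^n * x)⌋₊ : ℝ) / ((b^k : ℕ):ℝ))) / (N:ℂ) := by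
    rw [← Finset.sum_fiberwise_of_maps_to (s := range N) (t := range (b^k))
      (g := fun n => ⌊(b:ℝ)^k * Int.fract ((b:ℝ)^n * x)⌋₊), sum_div]
    · apply sum_congr rfl
      intro D _
      rw [sum_congr rfl (g := fun _ => eneg ((D:ℝ) / ((b^k : ℕ):ℝ)))]
      · rw [sum_const, nsmul_eq_mul]; push_cast; ring
      · intro n hn
        rw [(Finset.mem_filter.1 hn).2]
    · intro n _
      rw [mem_range, Nat.floor_lt (mul_nonneg (by positivity) (Int.fract_nonneg _))]
      push_cast
      have := Int.fract_lt_one ((b:ℝ)^n * x)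
      nlinarith [pow_pos (show (0:ℝ) < b by linarith) k]
  rw [hfib] at h1
  have hdiff : ‖(∑ n ∈ range N, eneg ((b:ℝ)^n * x)) / (N:ℂ) -
      (∑ n ∈ range N, eneg ((⌊(b:ℝ)^k * Int.fract ((b:ℝ)^n * x)⌋₊ : ℝ) / ((b^k : ℕ):ℝ))) / (N:ℂ)‖
      ≤ 2 * Real.pi / (b:ℝ)^k := by
    rw [← sub_div, ← sum_sub_distrib, norm_div, Complex.norm_natCast, div_le_iff₀ hNpos]
    calc _ ≤ ∑ n ∈ range N, ‖eneg ((b:ℝ)^n * x) - eneg ((⌊(b:ℝ)^k * Int.fract ((b:ℝ)^n * x)⌋₊ : ℝ) / ((b^k : ℕ):ℝ))‖ := norm_sum_le _ _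
      _ ≤ ∑ n ∈ range N, 2 * Real.pi / (b:ℝ)^k := by
          apply sum_le_sum
          intro n _
          set y := (b:ℝ)^n * x with hy
          have e1 : eneg y = eneg (Int.fract y) := by
            rw [← Int.self_sub_floor, eneg_sub_int]
          rw [e1]
          refine (eneg_lip _ _).trans ?_
          rw [show 2 * Real.pi / (b:ℝ)^k = 2 * Real.pi * (1 / (b:ℝ)^k) by ring]
          refine mul_le_mul_of_nonneg_left ?_ (by positivity)
          have hp : (0:ℝ) < (b:ℝ)^k := by positivity
          have l1 := Nat.floor_le (a := (b:ℝ)^k * Int.fract y) (mul_nonneg hp.le (Int.fract_nonneg _))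
          have l2 := Nat.lt_floor_add_one ((b:ℝ)^k * Int.fract y)
          push_cast
          have e2 : Int.fract y - (⌊(b:ℝ)^k * Int.fract y⌋₊ : ℝ) / (b:ℝ)^k
              = ((b:ℝ)^k * Int.fract y - ⌊(b:ℝ)^k * Int.fract y⌋₊) / (b:ℝ)^k := by field_simp
          rw [e2, abs_of_nonneg (div_nonneg (by linarith) hp.le)]
          gcongr
          linarith
      _ = _ := by simp; ring
  calc _ = ‖((∑ n ∈ range N, eneg ((b:ℝ)^n * x)) / (N:ℂ) -
      (∑ n ∈ range N, eneg ((⌊(b:ℝ)^k * Int.fract ((b:ℝ)^n * x)⌋₊ : ℝ) / ((b^k : ℕ):ℝ))) / (N:ℂ))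
      + (∑ n ∈ range N, eneg ((⌊(b:ℝ)^k * Int.fract ((b:ℝ)^n * x)⌋₊ : ℝ) / ((b^k : ℕ):ℝ))) / (N:ℂ)‖ := by
        rw [sub_add_cancel]
    _ ≤ _ := norm_add_le _ _
    _ < ε := by linarith

lemma isNormal_fract (b : ℕ) (x : ℝ) : IsNormal b (Int.fract x) ↔ IsNormal b x := by
  unfold IsNormal digit
  simp only [Int.fract_fract]


lemma integral_eneg (l : ℤ) : ∫ x in (0:ℝ)..1, eneg ((l:ℝ) * x) = if l = 0 then 1 else 0 := by
  split_ifs with h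
  · subst h; simp [eneg]
  · have hc : -(2 * (Real.pi:ℂ) * Complex.I * (l:ℂ)) ≠ 0 := by
      simp [Real.pi_ne_zero, h, Complex.I_ne_zero]
    have := integral_exp_mul_complex (a := 0) (b := 1) hc
    have e : ∀ x : ℝ, eneg ((l:ℝ) * x) = Complex.exp (-(2 * (Real.pi:ℂ) * Complex.I * (l:ℂ)) * x) := by
      intro x; unfold eneg; congr 1; push_cast; ring
    simp_rw [e]
    rw [this]
    have e2 : Complex.exp (-(2 * (Real.pi:ℂ) * Complex.I * (l:ℂ)) * ((1:ℝ):ℂ)) = 1 := by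
      rw [← e, mul_one]; exact eneg_int l
    rw [e2]; simp

lemma weyl_continuous (y : ℕ → ℝ)
    (hy : ∀ h : ℕ, 1 ≤ h → Tendsto (fun N : ℕ => (∑ n ∈ range N, eneg (h * y n)) / (N:ℂ)) atTop (nhds 0))
    (f : C(UnitAddCircle, ℂ)) :
    Tendsto (fun N : ℕ => (∑ n ∈ range N, f (y n : UnitAddCircle)) / (N:ℂ)) atTop
      (nhds (∫ t : UnitAddCircle, f t)) := by
  have hfour : ∀ (l : ℤ) (x : ℝ), (fourier l : C(UnitAddCircle, ℂ)) (x : UnitAddCircle) = eneg (((-l : ℤ):ℝ) * x) := by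
    intro l x
    rw [fourier_coe_apply]; unfold eneg; congr 1; push_cast; ring
  have hspan : ∀ g ∈ Submodule.span ℂ (Set.range (fun l : ℤ => (fourier l : C(UnitAddCircle, ℂ)))),
      Tendsto (fun N : ℕ => (∑ n ∈ range N, g (y n : UnitAddCircle)) / (N:ℂ)) atTop
      (nhds (∫ t : UnitAddCircle, g t)) := by
    intro g hg
    induction hg using Submodule.span_induction with
    | mem g hg =>
      obtain ⟨l, rfl⟩ := hg
      have hI : ∫ t : UnitAddCircle, (fourier l : C(UnitAddCircle, ℂ)) t = if -l = 0 then 1 else 0 := by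
        rw [← UnitAddCircle.integral_preimage 0, ← integral_eneg, intervalIntegral.integral_of_le (by norm_num)]
        simp_rw [hfour]; simp
      simp only [hI, hfour]
      split_ifs with h
      · rw [h]
        refine tendsto_const_nhds.congr' ?_
        filter_upwards [eventually_ge_atTop 1] with N hN
        have : (N:ℂ) ≠ 0 := by exact_mod_cast (by omega : N ≠ 0)
        simp [eneg, this]
      · rcases lt_or_gt_of_ne h with h | h
        · have h1 := hy l.natAbs (by omega)
          have h2 := (Complex.continuous_conj.tendsto 0).comp h1
          rw [map_zero] at h2
          refine h2.congr fun N => ?_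
          simp only [Function.comp, map_div₀, map_sum, eneg_conj, Complex.conj_natCast]
          congr 1
          apply sum_congr rfl
          intro n _
          congr 1
          have : (l.natAbs : ℤ) = l := by omega
          have : (l.natAbs : ℝ) = (l:ℝ) := by
            calc (l.natAbs : ℝ) = ((l.natAbs : ℤ) : ℝ) := (Int.cast_natCast _).symm
              _ = _ := by rw [this]
          rw [this]; push_cast; ring
        · have h1 := hy l.natAbs (by omega)
          refine h1.congr fun N => ?_
          congr 1
          apply sum_congr rfl
          intro n _
          congr 1
          have : (l.natAbs : ℤ) = -l := by omega
          have : (l.natAbs : ℝ) = ((-l:ℤ):ℝ) := by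
            calc (l.natAbs : ℝ) = ((l.natAbs : ℤ) : ℝ) := (Int.cast_natCast _).symm
              _ = _ := by rw [this]
          rw [this]
    | zero => simp
    | add g1 g2 _ _ h1 h2 =>
      have i1 : Integrable (fun t => g1 t) (volume : Measure UnitAddCircle) :=
        g1.continuous.integrable_of_hasCompactSupport (HasCompactSupport.of_compactSpace _)
      have i2 : Integrable (fun t => g2 t) (volume : Measure UnitAddCircle) :=
        g2.continuous.integrable_of_hasCompactSupport (HasCompactSupport.of_compactSpace _)
      simp only [ContinuousMap.add_apply]
      rw [integral_add i1 i2]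
      refine (h1.add h2).congr fun N => ?_
      rw [sum_add_distrib, add_div]
    | smul a g _ h1 =>
      simp only [ContinuousMap.smul_apply]
      rw [integral_smul]
      refine (h1.const_smul a).congr fun N => ?_
      rw [← smul_sum, smul_div_assoc]
  have hmem : f ∈ closure (Submodule.span ℂ (Set.range (fun l : ℤ => (fourier l : C(UnitAddCircle, ℂ)))) : Set C(UnitAddCircle, ℂ)) := by
    have := @span_fourier_closure_eq_top 1 _
    rw [← Submodule.topologicalClosure_coe, this]; trivial
  rw [Metric.tendsto_atTop]
  intro ε hε
  obtain ⟨g, hg, hfg⟩ := Metric.mem_closure_iff.1 hmem (ε/3) (by positivity)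
  obtain ⟨N0, hN0⟩ := Metric.tendsto_atTop.1 (hspan g hg) (ε/3) (by positivity)
  refine ⟨N0 + 1, fun N hN => ?_⟩
  have h1 := hN0 N (by omega)
  have hpt : ∀ t, ‖f t - g t‖ ≤ ε/3 := fun t => by
    rw [← dist_eq_norm]; exact (ContinuousMap.dist_apply_le_dist t).trans hfg.le
  have i1 : Integrable (fun t => f t) (volume : Measure UnitAddCircle) :=
    f.continuous.integrable_of_hasCompactSupport (HasCompactSupport.of_compactSpace _)
  have i2 : Integrable (fun t => g t) (volume : Measure UnitAddCircle) :=
    g.continuous.integrable_of_hasCompactSupport (HasCompactSupport.of_compactSpace _)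
  have h2 : ‖(∫ t : UnitAddCircle, g t) - ∫ t : UnitAddCircle, f t‖ ≤ ε/3 := by
    rw [← integral_sub i2 i1]
    have := norm_integral_le_of_norm_le_const (μ := (volume : Measure UnitAddCircle))
      (f := fun t => g t - f t) (C := ε/3) (Eventually.of_forall fun t => by
        rw [norm_sub_rev]; exact hpt t)
    simpa [measureReal_def, UnitAddCircle.measure_univ] using this
  have hNpos : (0:ℝ) < N := by exact_mod_cast (by omega : 0 < N)
  have h3 : ‖(∑ n ∈ range N, f (y n : UnitAddCircle)) / (N:ℂ) - (∑ n ∈ range N, g (y n : UnitAddCircle)) / (N:ℂ)‖ ≤ ε/3 := by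
    rw [← sub_div, ← sum_sub_distrib, norm_div, Complex.norm_natCast, div_le_iff₀ hNpos]
    calc _ ≤ ∑ n ∈ range N, ‖f (y n : UnitAddCircle) - g (y n : UnitAddCircle)‖ := norm_sum_le _ _
      _ ≤ ∑ n ∈ range N, ε/3 := sum_le_sum fun n _ => hpt _
      _ = _ := by simp; ring
  rw [dist_eq_norm] at h1 ⊢
  set a1 := (∑ n ∈ range N, f (y n : UnitAddCircle)) / (N:ℂ)
  set a2 := (∑ n ∈ range N, g (y n : UnitAddCircle)) / (N:ℂ)
  set I1 := ∫ t : UnitAddCircle, f t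
  set I2 := ∫ t : UnitAddCircle, g t
  calc ‖a1 - I1‖ = ‖(a1 - a2) + (a2 - I2) + (I2 - I1)‖ := by congr 1; ring
    _ ≤ ‖a1 - a2‖ + ‖a2 - I2‖ + ‖I2 - I1‖ := norm_add₃_le
    _ < ε := by linarith

lemma weyl_upper (y : ℕ → ℝ)
    (hy : ∀ h : ℕ, 1 ≤ h → Tendsto (fun N : ℕ => (∑ n ∈ range N, eneg (h * y n)) / (N:ℂ)) atTop (nhds 0))
    (M D : ℕ) (hM : 1 ≤ M) (ε : ℝ) (hε : 0 < ε) :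
    ∀ᶠ N : ℕ in atTop, (((range N).filter fun n => ⌊(M:ℝ) * Int.fract (y n)⌋₊ = D).card : ℝ) / N
      ≤ 1 / M + ε := by
  have hMR : (1:ℝ) ≤ M := by exact_mod_cast hM
  set δ := ε / 4 with hδ
  have hδ0 : 0 < δ := by positivity
  set c : ℝ := (D + 1/2) / M with hc
  set r : ℝ := 1 / (2 * M) with hr
  have hr0 : 0 < r := by positivity
  let F : UnitAddCircle → ℝ := fun t => max 0 (min 1 (1 - (‖t - (c : UnitAddCircle)‖ - r) / δ))
  have hFc : Continuous F := by
    simp only [F]; fun_prop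
  have hF0 : ∀ t, 0 ≤ F t := fun t => le_max_left _ _
  have hF1 : ∀ t, F t ≤ 1 := fun t => max_le (by norm_num) (min_le_left _ _)
  let G : C(UnitAddCircle, ℂ) := ⟨fun t => ((F t : ℝ) : ℂ), Complex.continuous_ofReal.comp hFc⟩
  have hlim := weyl_continuous y hy G
  have hI : ∫ t : UnitAddCircle, G t = ((∫ t : UnitAddCircle, F t : ℝ) : ℂ) := integral_ofReal
  rw [hI] at hlim
  have hlim2 : Tendsto (fun N : ℕ => (∑ n ∈ range N, F (y n : UnitAddCircle)) / (N:ℝ)) atTop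
      (nhds (∫ t : UnitAddCircle, F t)) := by
    have := (Complex.continuous_re.tendsto _).comp hlim
    rw [Complex.ofReal_re] at this
    refine this.congr fun N => ?_
    have e : (∑ n ∈ range N, G (y n : UnitAddCircle)) / (N:ℂ)
        = (((∑ n ∈ range N, F (y n : UnitAddCircle)) / (N:ℝ) : ℝ) : ℂ) := by
      push_cast; rfl
    simp only [Function.comp]
    rw [e, Complex.ofReal_re]
  have hIF : ∫ t : UnitAddCircle, F t ≤ 1 / M + 2 * δ := by
    have hle : ∫ t : UnitAddCircle, F t ≤ ∫ t : UnitAddCircle, (Metric.closedBall (c : UnitAddCircle) (r + δ)).indicator (fun _ => (1:ℝ)) t := by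
      apply integral_mono
      · exact hFc.integrable_of_hasCompactSupport (HasCompactSupport.of_compactSpace _)
      · exact (integrable_const _).indicator Metric.isClosed_closedBall.measurableSet
      · intro t
        by_cases ht : t ∈ Metric.closedBall (c : UnitAddCircle) (r + δ)
        · rw [Set.indicator_of_mem ht]; exact hF1 t
        · rw [Set.indicator_of_notMem ht]
          simp only [F]
          rw [Metric.mem_closedBall, dist_eq_norm] at ht
          push Not at ht
          have : 1 - (‖t - (c : UnitAddCircle)‖ - r) / δ ≤ 0 := by
            rw [sub_nonpos, le_div_iff₀ hδ0]; linarith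
          exact max_le le_rfl ((min_le_right _ _).trans this)
    refine hle.trans ?_
    rw [integral_indicator Metric.isClosed_closedBall.measurableSet]
    simp only [integral_const, smul_eq_mul, mul_one, measureReal_restrict_apply_univ]
    rw [measureReal_def, AddCircle.volume_closedBall, ENNReal.toReal_ofReal (by positivity)]
    refine (min_le_right _ _).trans (le_of_eq ?_)
    rw [hr]; field_simp
  have hev := hlim2.eventually (gt_mem_nhds (show ∫ t : UnitAddCircle, F t < 1 / M + ε by rw [hδ] at hIF; linarith))
  filter_upwards [hev] with N hN
  refine le_trans ?_ hN.le
  gcongr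
  rw [Finset.card_filter]
  push_cast
  apply sum_le_sum
  intro n _
  split_ifs with h
  · simp only [F]
    have hfr : 0 ≤ (M:ℝ) * Int.fract (y n) := mul_nonneg (by positivity) (Int.fract_nonneg _)
    have l1 := Nat.floor_le hfr
    have l2 := Nat.lt_floor_add_one ((M:ℝ) * Int.fract (y n))
    rw [h] at l1 l2
    have hd : ‖(y n : UnitAddCircle) - (c : UnitAddCircle)‖ ≤ r := by
      have e : (y n : UnitAddCircle) = ((Int.fract (y n) : ℝ) : UnitAddCircle) := by
        conv_lhs => rw [← Int.fract_add_floor (y n), show ((⌊y n⌋ : ℤ) : ℝ) = ⌊y n⌋ • (1:ℝ) by simp]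
        rw [AddCircle.coe_add, AddCircle.coe_zsmul, AddCircle.coe_period, smul_zero, add_zero]
      rw [e, ← AddCircle.coe_sub]
      rw [UnitAddCircle.norm_eq]
      refine (round_le _ 0).trans ?_
      rw [Int.cast_zero, sub_zero]
      rw [hc, hr, abs_le]
      constructor
      · rw [neg_le, neg_sub, sub_le_iff_le_add, div_le_iff₀ (by positivity), add_mul]
        have : 1 / (2 * (M:ℝ)) * M = 1/2 := by field_simp
        rw [this]; linarith
      · rw [sub_le_iff_le_add, ← sub_le_iff_le_add', le_div_iff₀ (by positivity), sub_mul]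
        have : 1 / (2 * (M:ℝ)) * M = 1/2 := by field_simp
        rw [this]; linarith
    have : 1 ≤ 1 - (‖(y n : UnitAddCircle) - (c : UnitAddCircle)‖ - r) / δ := by
      have : (‖(y n : UnitAddCircle) - (c : UnitAddCircle)‖ - r) / δ ≤ 0 :=
        div_nonpos_of_nonpos_of_nonneg (by linarith) hδ0.le
      linarith
    rw [min_eq_left this]; norm_num
  · exact hF0 _

lemma weyl_normal (b : ℕ) (hb : 2 ≤ b) (x : ℝ)
    (hx : ∀ h : ℕ, 1 ≤ h → Tendsto (fun N : ℕ => (∑ n ∈ range N, eneg (h * (b:ℝ)^n * x)) / (N:ℂ)) atTop (nhds 0)) :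
    IsNormal b x := by
  rw [isNormal_iff b hb]
  intro k hk D hD
  set M := b^k with hM
  have hM1 : 1 ≤ M := Nat.one_le_pow _ _ (by omega)
  have hMR : (1:ℝ) ≤ M := by exact_mod_cast hM1
  have hMe : (b:ℝ)^k = (M:ℝ) := by rw [hM]; push_cast; rfl
  rw [hMe]
  have hy : ∀ h : ℕ, 1 ≤ h → Tendsto (fun N : ℕ => (∑ n ∈ range N, eneg (h * ((b:ℝ)^n * x))) / (N:ℂ)) atTop (nhds 0) := by
    intro h hh
    simpa only [mul_assoc] using hx h hh
  have hup := fun D => weyl_upper (fun n => (b:ℝ)^n * x) hy M D hM1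
  rw [Metric.tendsto_atTop]
  intro ε hε
  set η := ε / (2 * M) with hη
  have hη0 : 0 < η := by positivity
  have hall : ∀ᶠ N : ℕ in atTop, ∀ D ∈ range M,
      (((range N).filter fun n => ⌊(M:ℝ) * Int.fract ((b:ℝ)^n * x)⌋₊ = D).card : ℝ) / N ≤ 1 / M + η := by
    rw [Filter.eventually_all_finset]
    intro D _
    exact hup D η hη0
  obtain ⟨N0, hN0⟩ := (hall.and (eventually_ge_atTop 1)).exists_forall_of_atTop
  refine ⟨N0, fun N hN => ?_⟩
  obtain ⟨h1, h2⟩ := hN0 N hN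
  have hNpos : (0:ℝ) < N := by exact_mod_cast h2
  have hsum : ∑ D ∈ range M,
      (((range N).filter fun n => ⌊(M:ℝ) * Int.fract ((b:ℝ)^n * x)⌋₊ = D).card : ℝ) / N = 1 := by
    rw [← sum_div, div_eq_one_iff_eq hNpos.ne']
    have := Finset.card_eq_sum_card_fiberwise (s := range N) (t := range M)
      (f := fun n => ⌊(M:ℝ) * Int.fract ((b:ℝ)^n * x)⌋₊) (by
        intro n _
        simp only [coe_range, Set.mem_Iio]
        rw [Nat.floor_lt (mul_nonneg (by positivity) (Int.fract_nonneg _))]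
        have := Int.fract_lt_one ((b:ℝ)^n * x)
        nlinarith)
    rw [card_range] at this
    exact_mod_cast this.symm
  set q : ℕ → ℝ := fun D => (((range N).filter fun n => ⌊(M:ℝ) * Int.fract ((b:ℝ)^n * x)⌋₊ = D).card : ℝ) / N with hq
  have hDm : D ∈ range M := mem_range.2 hD
  rw [← Finset.add_sum_erase _ _ hDm] at hsum
  have hrest : ∑ D' ∈ (range M).erase D, q D' ≤ (M - 1) * (1 / M + η) := by
    calc _ ≤ ∑ D' ∈ (range M).erase D, (1 / M + η) := sum_le_sum fun D' hD' => h1 D' (mem_of_mem_erase hD')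
      _ = _ := by
        rw [sum_const, card_erase_of_mem hDm, card_range, nsmul_eq_mul, Nat.cast_sub hM1]; simp
  have hηM : η * M = ε / 2 := by rw [hη]; field_simp
  have hqD := h1 D hDm
  have e : ((M:ℝ) - 1) * (1 / M + η) = 1 - 1 / M + η * M - η := by field_simp; ring
  rw [e] at hrest
  change dist (q D) _ < ε
  rw [Real.dist_eq, abs_lt]
  have hηε : η ≤ ε / 2 := by nlinarith
  constructor
  · linarith
  · have : q D ≤ 1 / M + η := hqD
    linarith


/-- Real trigonometric polynomials, as finitely supported coefficient families on `ℤ`. -/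
abbrev TP := AddMonoidAlgebra ℝ ℤ

/-- The character `m ↦ e^{2πi m x}`. -/
noncomputable def tpChar (x : ℝ) : Multiplicative ℤ →* ℂ where
  toFun m := eneg (-(((Multiplicative.toAdd m : ℤ) : ℝ) * x))
  map_one' := by simp [eneg]
  map_mul' a c := by
    rw [← eneg_add]; congr 1; rw [toAdd_mul]; push_cast; ring

/-- Evaluation at `x`. -/
noncomputable def ev (x : ℝ) : TP →ₐ[ℝ] ℂ := AddMonoidAlgebra.lift ℝ ℂ ℤ (tpChar x)

lemma ev_apply (x : ℝ) (F : TP) :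
    ev x F = ∑ m ∈ F.coeff.support, (F.coeff m : ℂ) * eneg (-((m:ℝ) * x)) := by
  unfold ev
  rw [AddMonoidAlgebra.lift_apply]
  rfl

lemma ev_single (x : ℝ) (m : ℤ) (c : ℝ) :
    ev x (AddMonoidAlgebra.single m c) = (c : ℂ) * eneg (-((m:ℝ) * x)) := by
  unfold ev
  rw [AddMonoidAlgebra.lift_single]
  rfl

lemma ev_cont (F : TP) : Continuous (fun x => ev x F) := by
  simp_rw [ev_apply]
  apply continuous_finsetSum
  intro m _
  exact continuous_const.mul (eneg_cont.comp (by fun_prop))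

/-- Nonnegative trigonometric polynomials with nonnegative coefficients. -/
structure Good (F : TP) : Prop where
  pos : ∀ x, ∃ r : ℝ, 0 ≤ r ∧ ev x F = r
  nn : ∀ l, 0 ≤ F.coeff l

lemma tp_coeff_mul (F G : TP) (l : ℤ) :
    (F * G).coeff l = ∑ a ∈ F.coeff.support, F.coeff a * G.coeff (l - a) := by
  rw [AddMonoidAlgebra.coeff_mul_apply_left]
  unfold Finsupp.sum
  apply sum_congr rfl
  intro a _
  change F.coeff a * G.coeff (-a + l) = _
  rw [neg_add_eq_sub]

lemma Good.mul {F G : TP} (hF : Good F) (hG : Good G) : Good (F * G) where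
  pos x := by
    obtain ⟨r, h1, h2⟩ := hF.pos x
    obtain ⟨s, h3, h4⟩ := hG.pos x
    exact ⟨r * s, by positivity, by rw [map_mul, h2, h4]; push_cast; rfl⟩
  nn l := by
    rw [tp_coeff_mul]
    exact sum_nonneg fun a _ => mul_nonneg (hF.nn _) (hG.nn _)

lemma Good.smul {F : TP} (hF : Good F) {c : ℝ} (hc : 0 ≤ c) : Good (c • F) where
  pos x := by
    obtain ⟨r, h1, h2⟩ := hF.pos x
    exact ⟨c * r, by positivity, by rw [map_smul, h2]; simp⟩
  nn l := by
    rw [AddMonoidAlgebra.coeff_smul_apply]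
    exact mul_nonneg hc (hF.nn _)

lemma tp_coeff_sum {ι : Type} (s : Finset ι) (f : ι → TP) (l : ℤ) :
    (∑ i ∈ s, f i).coeff l = ∑ i ∈ s, (f i).coeff l := by
  rw [AddMonoidAlgebra.coeff_sum, Finsupp.finsetSum_apply]

lemma Good.sum {ι : Type} {s : Finset ι} {f : ι → TP} (hf : ∀ i ∈ s, Good (f i)) :
    Good (∑ i ∈ s, f i) where
  pos x := by
    classical
    induction s using Finset.induction_on with
    | empty => exact ⟨0, le_rfl, by simp⟩
    | insert a s ha ih =>
      obtain ⟨r, h1, h2⟩ := ih (fun i hi => hf i (mem_insert_of_mem hi))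
      obtain ⟨t, h3, h4⟩ := (hf a (mem_insert_self _ _)).pos x
      exact ⟨t + r, by positivity, by rw [sum_insert ha, map_add, h2, h4]; push_cast; rfl⟩
  nn l := by
    rw [tp_coeff_sum]
    exact sum_nonneg fun i hi => (hf i hi).nn l

lemma tp_coeff_one (l : ℤ) : (1 : TP).coeff l = if l = 0 then 1 else 0 := by
  rw [AddMonoidAlgebra.one_def, AddMonoidAlgebra.coeff_single, Finsupp.single_apply]
  simp [eq_comm]

lemma Good.one : Good (1 : TP) where
  pos x := ⟨1, by norm_num, by simp⟩
  nn l := by rw [tp_coeff_one]; split_ifs <;> norm_num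

lemma coeff_mul_ge {F G : TP} (hF : Good F) (hG : Good G) (a b : ℤ) :
    F.coeff a * G.coeff b ≤ (F * G).coeff (a + b) := by
  rw [tp_coeff_mul]
  by_cases ha : a ∈ F.coeff.support
  · have := single_le_sum (f := fun a' => F.coeff a' * G.coeff (a + b - a'))
      (fun i _ => mul_nonneg (hF.nn i) (hG.nn _)) ha
    simpa using this
  · rw [Finsupp.notMem_support_iff] at ha
    rw [ha, zero_mul]
    exact sum_nonneg fun a _ => mul_nonneg (hF.nn _) (hG.nn _)

lemma supp_mul {F G : TP} {l : ℤ} (h : (F * G).coeff l ≠ 0) :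
    ∃ a b, F.coeff a ≠ 0 ∧ G.coeff b ≠ 0 ∧ l = a + b := by
  rw [tp_coeff_mul] at h
  obtain ⟨a, _, ha⟩ := exists_ne_zero_of_sum_ne_zero h
  exact ⟨a, l - a, left_ne_zero_of_mul ha, right_ne_zero_of_mul ha, by ring⟩

lemma sep_mul {F G : TP} {M : ℤ} (hF : ∀ a, F.coeff a ≠ 0 → 2 * |a| < M)
    (hG : ∀ b, G.coeff b ≠ 0 → M ∣ b) {a b : ℤ} (ha : 2 * |a| < M) (hb : M ∣ b) :
    (F * G).coeff (a + b) = F.coeff a * G.coeff b := by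
  rw [tp_coeff_mul]
  have key : ∀ a' ∈ F.coeff.support, a' ≠ a → F.coeff a' * G.coeff (a + b - a') = 0 := by
    intro a' ha' hne
    have h1 := hF a' (Finsupp.mem_support_iff.1 ha')
    by_contra hcon
    have h2 := hG _ (right_ne_zero_of_mul hcon)
    have h3 : M ∣ a - a' := by
      have := dvd_sub h2 hb
      rwa [show a + b - a' - b = a - a' by ring] at this
    have h4 : |a - a'| < M := by
      have := abs_sub a a'
      omega
    have := Int.eq_zero_of_abs_lt_dvd h3 h4
    omega
  by_cases h : a ∈ F.coeff.support
  · rw [sum_eq_single_of_mem a h key]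
    simp
  · rw [sum_eq_zero, Finsupp.notMem_support_iff.1 h, zero_mul]
    intro a' ha'
    exact key a' ha' (fun e => h (e ▸ ha'))

lemma integral_ev (F : TP) (l : ℤ) :
    ∫ x in Set.Ico (0:ℝ) 1, eneg ((l:ℝ) * x) * ev x F = F.coeff l := by
  have e : ∀ x : ℝ, eneg ((l:ℝ) * x) * ev x F
      = ∑ m ∈ F.coeff.support, (F.coeff m : ℂ) * eneg (((l - m : ℤ) : ℝ) * x) := by
    intro x
    rw [ev_apply, mul_sum]
    apply sum_congr rfl
    intro m _
    rw [mul_left_comm, ← eneg_add]; congr 2; push_cast; ring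
  simp_rw [e]
  rw [integral_Ico_eq_integral_Ioc, ← intervalIntegral.integral_of_le (by norm_num),
    intervalIntegral.integral_finsetSum]
  · simp_rw [intervalIntegral.integral_const_mul, integral_eneg]
    simp only [sub_eq_zero, mul_ite, mul_one, mul_zero]
    rw [sum_ite_eq]
    split_ifs with h
    · rfl
    · rw [Finsupp.notMem_support_iff.1 h]; simp
  · intro m _
    apply Continuous.intervalIntegrable
    exact continuous_const.mul (eneg_cont.comp (by fun_prop))

/-- The (real) density. -/
noncomputable def tdens (F : TP) (x : ℝ) : ℝ := (ev x F).re

lemma dens_cont (F : TP) : Continuous (tdens F) := Complex.continuous_re.comp (ev_cont F)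

lemma Good.dens_nonneg {F : TP} (hF : Good F) (x : ℝ) : 0 ≤ tdens F x := by
  obtain ⟨r, h1, h2⟩ := hF.pos x
  unfold tdens; rw [h2]; simpa

lemma Good.dens_eq {F : TP} (hF : Good F) (x : ℝ) : ev x F = tdens F x := by
  obtain ⟨r, h1, h2⟩ := hF.pos x
  unfold tdens; rw [h2]; simp

lemma cont_intOn (f : ℝ → ℝ) (hf : Continuous f) : IntegrableOn f (Set.Ico (0:ℝ) 1) :=
  (hf.continuousOn.integrableOn_Icc).mono_set Set.Ico_subset_Icc_self

lemma cont_intOnC (f : ℝ → ℂ) (hf : Continuous f) : IntegrableOn f (Set.Ico (0:ℝ) 1) :=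
  (hf.continuousOn.integrableOn_Icc).mono_set Set.Ico_subset_Icc_self

/-- The measure with density `F` on `[0,1)`. -/
noncomputable def muF (F : TP) : Measure ℝ :=
  (volume.restrict (Set.Ico (0:ℝ) 1)).withDensity (fun x => ENNReal.ofReal (tdens F x))

lemma Good.integral_dens {F : TP} (hF : Good F) : ∫ x in Set.Ico (0:ℝ) 1, tdens F x = F.coeff 0 := by
  have := integral_ev F 0
  have e : ∀ x : ℝ, eneg (((0:ℤ):ℝ) * x) * ev x F = ((tdens F x : ℝ) : ℂ) := by
    intro x; rw [hF.dens_eq]; simp [eneg]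
  simp_rw [e] at this
  rw [integral_complex_ofReal] at this
  exact_mod_cast this

lemma Good.muF_apply {F : TP} (hF : Good F) {S : Set ℝ} (hS : MeasurableSet S) :
    muF F S = ENNReal.ofReal (∫ x in Set.Ico (0:ℝ) 1, S.indicator (tdens F) x) := by
  unfold muF
  rw [withDensity_apply _ hS, ← lintegral_indicator hS, ofReal_integral_eq_lintegral_ofReal]
  · apply lintegral_congr
    intro x
    by_cases h : x ∈ S <;> simp [h]
  · exact (cont_intOn _ (dens_cont F)).indicator hS
  · exact Eventually.of_forall fun x => Set.indicator_nonneg (fun x _ => hF.dens_nonneg x) x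

lemma Good.muF_prob {F : TP} (hF : Good F) (h1 : F.coeff 0 = 1) : IsProbabilityMeasure (muF F) := by
  constructor
  rw [hF.muF_apply MeasurableSet.univ]
  simp only [Set.indicator_univ]
  rw [hF.integral_dens, h1, ENNReal.ofReal_one]

lemma Good.muHat_muF {F : TP} (hF : Good F) (l : ℤ) : muHat (muF F) l = F.coeff l := by
  unfold muHat muF
  rw [integral_withDensity_eq_integral_toReal_smul
    ((dens_cont F).measurable.ennreal_ofReal)
    (Eventually.of_forall fun x => ENNReal.ofReal_lt_top), ← integral_ev]
  apply integral_congr_ae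
  refine Eventually.of_forall fun x => ?_
  simp only
  rw [ENNReal.toReal_ofReal (hF.dens_nonneg x), hF.dens_eq, Complex.real_smul, mul_comm]

lemma muHat_neg (μ : Measure ℝ) (l : ℤ) : muHat μ (-l) = (starRingEnd ℂ) (muHat μ l) := by
  unfold muHat
  rw [← integral_conj]
  congr 1
  ext x
  rw [eneg_conj]; congr 1; push_cast; ring

lemma Good.coeff_neg {F : TP} (hF : Good F) (l : ℤ) : F.coeff (-l) = F.coeff l := by
  have := muHat_neg (muF F) l
  rw [hF.muHat_muF, hF.muHat_muF, Complex.conj_ofReal] at this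
  exact_mod_cast this

lemma muHat_norm_le (μ : Measure ℝ) [IsProbabilityMeasure μ] (l : ℤ) : ‖muHat μ l‖ ≤ 1 := by
  unfold muHat
  have := norm_integral_le_of_norm_le_const (μ := μ) (f := fun x => eneg ((l:ℝ) * x)) (C := 1)
    (Eventually.of_forall fun x => (eneg_norm _).le)
  simpa using this

lemma Good.coeff_le_one {F : TP} (hF : Good F) (h1 : F.coeff 0 = 1) (l : ℤ) : F.coeff l ≤ 1 := by
  have := hF.muF_prob h1
  have h := muHat_norm_le (muF F) l
  rw [hF.muHat_muF, Complex.norm_real, Real.norm_eq_abs] at h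
  exact (le_abs_self _).trans h


/-- Fejér kernel of order `Q` dilated by `A^i`. -/
noncomputable def fej (A Q i : ℕ) : TP :=
  ((1:ℝ) / Q) • ∑ z ∈ range Q ×ˢ range Q,
    AddMonoidAlgebra.single ((A:ℤ)^i * ((z.1:ℤ) - (z.2:ℤ))) (1:ℝ)

lemma fej_coeff (A Q i : ℕ) (l : ℤ) : (fej A Q i).coeff l
    = (1 / (Q:ℝ)) * (((range Q ×ˢ range Q).filter fun z : ℕ × ℕ => (A:ℤ)^i * ((z.1:ℤ) - (z.2:ℤ)) = l).card : ℝ) := by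
  unfold fej
  rw [AddMonoidAlgebra.coeff_smul_apply, tp_coeff_sum, card_filter, smul_eq_mul]
  push_cast
  congr 1
  apply sum_congr rfl
  intro z _
  rw [AddMonoidAlgebra.coeff_single, Finsupp.single_apply]

lemma fej_good (A Q i : ℕ) : Good (fej A Q i) where
  nn l := by rw [fej_coeff]; positivity
  pos x := by
    set w : ℂ := ∑ k ∈ range Q, eneg (-(((A:ℝ)^i * k) * x)) with hw
    refine ⟨(1 / (Q:ℝ)) * ‖w‖^2, by positivity, ?_⟩
    unfold fej
    rw [map_smul, map_sum]
    simp only [ev_single]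
    have e : ∑ z ∈ range Q ×ˢ range Q,
        ((1:ℝ):ℂ) * eneg (-(((((A:ℤ)^i * ((z.1:ℤ) - (z.2:ℤ))) : ℤ) : ℝ) * x)) = ((‖w‖^2 : ℝ) : ℂ) := by
      rw [← Complex.normSq_eq_norm_sq, ← Complex.mul_conj, hw, map_sum, sum_mul_sum, ← sum_product']
      apply sum_congr rfl
      intro z _
      rw [eneg_conj, ← eneg_add, Complex.ofReal_one, one_mul]
      congr 1; push_cast; ring
    rw [e, Complex.real_smul]; push_cast; rfl

lemma fej_supp {A Q i : ℕ} {l : ℤ} (h : (fej A Q i).coeff l ≠ 0) :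
    ∃ q : ℤ, |q| ≤ (Q:ℤ) - 1 ∧ l = q * (A:ℤ)^i := by
  rw [fej_coeff] at h
  have h2 := right_ne_zero_of_mul h
  have h3 : ((range Q ×ˢ range Q).filter fun z : ℕ × ℕ => (A:ℤ)^i * ((z.1:ℤ) - (z.2:ℤ)) = l).Nonempty := by
    rw [← card_pos]; by_contra hc; apply h2
    have := Nat.eq_zero_of_not_pos hc
    exact_mod_cast this
  obtain ⟨z, hz⟩ := h3
  simp only [Finset.mem_filter, mem_product, mem_range] at hz
  refine ⟨(z.1:ℤ) - z.2, ?_, ?_⟩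
  · rw [abs_le]; omega
  · rw [← hz.2]; ring

lemma fej_zero {A Q i : ℕ} (hA : 1 ≤ A) (hQ : 1 ≤ Q) : (fej A Q i).coeff 0 = 1 := by
  rw [fej_coeff]
  have : ((range Q ×ˢ range Q).filter fun z : ℕ × ℕ => (A:ℤ)^i * ((z.1:ℤ) - (z.2:ℤ)) = 0).card = Q := by
    conv_rhs => rw [← card_range Q]
    symm
    apply card_bij (fun k _ => (k, k))
    · intro k hk
      simp only [Finset.mem_filter, mem_product]
      exact ⟨⟨hk, hk⟩, by ring⟩
    · intro a _ c _ h; exact (Prod.mk.inj h).1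
    · intro z hz
      simp only [Finset.mem_filter, mem_product] at hz
      refine ⟨z.1, hz.1.1, ?_⟩
      have hA0 : (A:ℤ)^i ≠ 0 := by positivity
      have := (mul_eq_zero.1 hz.2).resolve_left hA0
      ext
      · rfl
      · simp only; omega
  rw [this]
  have : (0:ℝ) < Q := by exact_mod_cast hQ
  field_simp

lemma fej_lower {A Q i q : ℕ} (hQ : 1 ≤ Q) (hq : q ≤ Q) :
    1 - (q:ℝ) / Q ≤ (fej A Q i).coeff ((A:ℤ)^i * q) := by
  rw [fej_coeff]
  have : Q - q ≤ ((range Q ×ˢ range Q).filter fun z : ℕ × ℕ => (A:ℤ)^i * ((z.1:ℤ) - (z.2:ℤ)) = (A:ℤ)^i * q).card := by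
    conv_lhs => rw [← card_range (Q - q)]
    apply card_le_card_of_injOn (fun k => (k + q, k))
    · intro k hk
      simp only [coe_range, Set.mem_Iio] at hk
      simp only [coe_filter, mem_product, mem_range, Set.mem_ofPred_eq]
      refine ⟨⟨by omega, by omega⟩, ?_⟩
      push_cast; ring
    · intro a _ c _ h; exact (Prod.mk.inj h).2
  have h2 : (Q:ℝ) - q ≤ (((range Q ×ˢ range Q).filter fun z : ℕ × ℕ => (A:ℤ)^i * ((z.1:ℤ) - (z.2:ℤ)) = (A:ℤ)^i * q).card : ℝ) := by
    rw [← Nat.cast_sub hq]; exact_mod_cast this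
  have hQR : (0:ℝ) < Q := by exact_mod_cast hQ
  calc 1 - (q:ℝ) / Q = (1 / (Q:ℝ)) * (Q - q) := by field_simp
    _ ≤ _ := by gcongr

/-- Riesz-type product over `i ∈ [p, p+n)`. -/
noncomputable def rp (A Q p n : ℕ) : TP := ∏ i ∈ range n, fej A Q (p + i)

lemma rp_good (A Q p n : ℕ) : Good (rp A Q p n) := by
  unfold rp
  induction n with
  | zero => simpa using Good.one
  | succ n ih => rw [prod_range_succ]; exact ih.mul (fej_good _ _ _)

lemma rp_supp {A Q U p : ℕ} (hU : 2 ≤ U) (hQ : 1 ≤ Q) (hA : A = Q * U) (n : ℕ) :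
    ∀ b, (rp A Q p n).coeff b ≠ 0 → (A:ℤ)^p ∣ b ∧ |b| * U ≤ (A:ℤ)^(p+n) ∧
      (b ≠ 0 → ∃ (i : ℕ) (q : ℤ), p ≤ i ∧ i < p + n ∧ 1 ≤ |q| ∧ |q| ≤ Q ∧ |b - q * (A:ℤ)^i| * U ≤ (A:ℤ)^i) := by
  have hA1 : 1 ≤ A := by rw [hA]; exact Nat.mul_pos (by omega) (by omega)
  induction n with
  | zero =>
    intro b hb
    have hb0 : b = 0 := by
      by_contra h
      apply hb
      simp only [rp, range_zero, prod_empty]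
      rw [tp_coeff_one, if_neg h]
    subst hb0
    refine ⟨dvd_zero _, ?_, fun h => absurd rfl h⟩
    simp only [abs_zero, zero_mul]; positivity
  | succ n ih =>
    intro b hb
    unfold rp at hb
    rw [prod_range_succ] at hb
    obtain ⟨b1, b2, h1, h2, rfl⟩ := supp_mul hb
    obtain ⟨g1, g2, g3⟩ := ih b1 h1
    obtain ⟨q, hq, rfl⟩ := fej_supp h2
    have hpos : (0:ℤ) < (A:ℤ)^(p+n) := by positivity
    refine ⟨?_, ?_, ?_⟩
    · exact dvd_add g1 (Dvd.dvd.mul_left (pow_dvd_pow _ (by omega)) _)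
    · have e1 : |b1 + q * (A:ℤ)^(p+n)| ≤ |b1| + |q| * (A:ℤ)^(p+n) := by
        refine (abs_add_le _ _).trans ?_
        rw [abs_mul, abs_of_pos hpos]
      have e2 : (A:ℤ)^(p+(n+1)) = (A:ℤ)^(p+n) * (Q * U) := by
        rw [← add_assoc, pow_succ]; congr 1; rw [hA]; push_cast; ring
      rw [e2]
      have hU' : (2:ℤ) ≤ U := by exact_mod_cast hU
      calc |b1 + q * (A:ℤ)^(p+n)| * U ≤ (|b1| + |q| * (A:ℤ)^(p+n)) * U := by gcongr
        _ = |b1| * U + |q| * ((A:ℤ)^(p+n) * U) := by ring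
        _ ≤ (A:ℤ)^(p+n) * U + (Q - 1) * ((A:ℤ)^(p+n) * U) := by
            have : |b1| * U ≤ (A:ℤ)^(p+n) * U := by nlinarith
            gcongr
        _ = _ := by ring
    · intro hne
      by_cases hq0 : q = 0
      · subst hq0
        simp only [zero_mul, add_zero] at hne ⊢
        obtain ⟨i, q, k1, k2, k3⟩ := g3 hne
        exact ⟨i, q, k1, by omega, k3⟩
      · refine ⟨p + n, q, by omega, by omega, Int.one_le_abs hq0, by omega, ?_⟩
        rw [add_sub_cancel_right]; exact g2

lemma rp_zero {A Q U p : ℕ} (hU : 4 ≤ U) (hQ : 1 ≤ Q) (hA : A = Q * U) (n : ℕ) :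
    (rp A Q p n).coeff 0 = 1 := by
  have hA1 : 1 ≤ A := by rw [hA]; exact Nat.mul_pos (by omega) (by omega)
  induction n with
  | zero => simp [rp, tp_coeff_one]
  | succ n ih =>
    have hs := rp_supp (p := p) (by omega : 2 ≤ U) hQ hA n
    unfold rp at ih hs ⊢
    rw [prod_range_succ]
    have hpos : (0:ℤ) < (A:ℤ)^(p+n) := by positivity
    have := sep_mul (F := ∏ i ∈ range n, fej A Q (p + i)) (G := fej A Q (p + n)) (M := (A:ℤ)^(p+n))
      (fun a ha => by
        have h1 := (hs a ha).2.1
        have hU' : (4:ℤ) ≤ U := by exact_mod_cast hU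
        nlinarith [abs_nonneg a])
      (fun b hb => by
        obtain ⟨q, _, rfl⟩ := fej_supp hb
        exact Dvd.intro_left _ rfl) (a := 0) (b := 0) (by simpa using hpos) (dvd_zero _)
    rw [add_zero] at this
    rw [this, ih, fej_zero hA1 hQ, mul_one]

lemma prod_ge_one {ι : Type} [DecidableEq ι] (s : Finset ι) (f : ι → TP) (hf : ∀ i ∈ s, Good (f i)) (h1 : ∀ i ∈ s, 1 ≤ (f i).coeff 0) :
    Good (∏ i ∈ s, f i) ∧ 1 ≤ (∏ i ∈ s, f i).coeff 0 := by
  induction s using Finset.induction_on with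
  | empty => simp [tp_coeff_one, Good.one]
  | insert a s ha ih =>
    obtain ⟨h2, h3⟩ := ih (fun i hi => hf i (mem_insert_of_mem hi)) (fun i hi => h1 i (mem_insert_of_mem hi))
    have h4 := hf a (mem_insert_self _ _)
    rw [prod_insert ha]
    refine ⟨h4.mul h2, ?_⟩
    have := coeff_mul_ge h4 h2 0 0
    rw [add_zero] at this
    have h5 := h1 a (mem_insert_self _ _)
    nlinarith

lemma rp_lower {A Q p n i q : ℕ} (hA : 1 ≤ A) (hQ : 1 ≤ Q) (hi : i < n) (hq : q ≤ Q) :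
    1 - (q:ℝ) / Q ≤ (rp A Q p n).coeff ((A:ℤ)^(p+i) * q) := by
  unfold rp
  rw [← mul_prod_erase _ _ (mem_range.2 hi)]
  obtain ⟨h1, h2⟩ := prod_ge_one ((range n).erase i) (fun i => fej A Q (p + i))
    (fun i _ => fej_good _ _ _) (fun i _ => (fej_zero hA hQ).ge)
  have := coeff_mul_ge (fej_good A Q (p+i)) h1 ((A:ℤ)^(p+i) * q) 0
  rw [add_zero] at this
  have h3 := fej_lower (A := A) (i := p + i) hQ hq
  have h4 := (fej_good A Q (p+i)).nn ((A:ℤ)^(p+i) * q)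
  nlinarith

/-- The stage multiplier. -/
noncomputable def stg (A Q J P : ℕ) : TP :=
  ((1:ℝ) / J) • ∑ j ∈ range J, rp A Q (2^j * P) (2^j * P)

lemma stg_good (A Q J P : ℕ) : Good (stg A Q J P) :=
  (Good.sum fun _ _ => rp_good _ _ _ _).smul (by positivity)

lemma stg_coeff (A Q J P : ℕ) (l : ℤ) :
    (stg A Q J P).coeff l = (1 / (J:ℝ)) * ∑ j ∈ range J, (rp A Q (2^j * P) (2^j * P)).coeff l := by
  unfold stg
  rw [AddMonoidAlgebra.coeff_smul_apply, tp_coeff_sum, smul_eq_mul]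

lemma stg_zero {A Q U J P : ℕ} (hU : 4 ≤ U) (hQ : 1 ≤ Q) (hA : A = Q * U) (hJ : 1 ≤ J) :
    (stg A Q J P).coeff 0 = 1 := by
  rw [stg_coeff]
  simp_rw [rp_zero hU hQ hA]
  have : (0:ℝ) < J := by exact_mod_cast hJ
  simp; field_simp

lemma stg_dvd {A Q U J P : ℕ} (hU : 4 ≤ U) (hQ : 1 ≤ Q) (hA : A = Q * U) {b : ℤ}
    (hb : (stg A Q J P).coeff b ≠ 0) : (A:ℤ)^P ∣ b := by
  rw [stg_coeff] at hb
  obtain ⟨j, _, hj⟩ := exists_ne_zero_of_sum_ne_zero (right_ne_zero_of_mul hb)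
  have := (rp_supp (by omega : 2 ≤ U) hQ hA _ b hj).1
  exact (pow_dvd_pow _ (Nat.le_mul_of_pos_left _ (by positivity))).trans this

lemma stg_le {A Q U J P : ℕ} (hU : 4 ≤ U) (hQ : 1 ≤ Q) (hA : A = Q * U) {b : ℤ}
    (hb0 : b ≠ 0) (hb : (stg A Q J P).coeff b ≠ 0) :
    (stg A Q J P).coeff b ≤ 1 / J ∧ ∃ j < J, ∃ (i : ℕ) (q : ℤ), 2^j * P ≤ i ∧ i < 2 * (2^j * P) ∧
      1 ≤ |q| ∧ |q| ≤ Q ∧ |b - q * (A:ℤ)^i| * U ≤ (A:ℤ)^i := by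
  have hA1 : 1 ≤ A := by rw [hA]; exact Nat.mul_pos (by omega) (by omega)
  have hA1' : (1:ℤ) ≤ A := by exact_mod_cast hA1
  have hU' : (4:ℤ) ≤ U := by exact_mod_cast hU
  rw [stg_coeff] at hb
  obtain ⟨j, hjJ, hj⟩ := exists_ne_zero_of_sum_ne_zero (right_ne_zero_of_mul hb)
  have hs := fun j' => rp_supp (p := 2^j' * P) (by omega : 2 ≤ U) hQ hA (2^j' * P) b
  constructor
  · rw [stg_coeff]
    have : ∑ j ∈ range J, (rp A Q (2^j * P) (2^j * P)).coeff b ≤ 1 := by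
      rw [sum_eq_single_of_mem j hjJ]
      · exact (rp_good _ _ _ _).coeff_le_one (rp_zero hU hQ hA _) b
      · intro j' _ hne
        by_contra hc
        have key : ∀ j1 j2 : ℕ, j1 < j2 → (rp A Q (2^j1 * P) (2^j1 * P)).coeff b ≠ 0 →
            (rp A Q (2^j2 * P) (2^j2 * P)).coeff b ≠ 0 → False := by
          intro j1 j2 hlt h1 h2
          have a1 := (hs j1 h1).2.1
          have a2 := Int.le_of_dvd (abs_pos.2 hb0) ((dvd_abs _ _).2 (hs j2 h2).1)
          have a3 : (A:ℤ)^(2^j1 * P + 2^j1 * P) ≤ (A:ℤ)^(2^j2 * P) := by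
            apply pow_le_pow_right₀ hA1'
            have : 2^(j1+1) ≤ 2^j2 := Nat.pow_le_pow_right (by norm_num) hlt
            rw [pow_succ] at this
            nlinarith
          have := abs_pos.2 hb0
          nlinarith
        rcases lt_or_gt_of_ne hne with h | h
        · exact key _ _ h hc hj
        · exact key _ _ h hj hc
    calc _ ≤ (1 / (J:ℝ)) * 1 := by gcongr
      _ = _ := mul_one _
  · obtain ⟨i, q, h1, h2, h3⟩ := (hs j hj).2.2 hb0
    exact ⟨j, mem_range.1 hjJ, i, q, h1, by omega, h3⟩

/-- degree -/
noncomputable def tdeg (F : TP) : ℕ := F.coeff.support.sup Int.natAbs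

lemma tdeg_le {F : TP} {a : ℤ} (h : F.coeff a ≠ 0) : |a| ≤ tdeg F := by
  have : a.natAbs ≤ tdeg F := Finset.le_sup (f := Int.natAbs) (Finsupp.mem_support_iff.2 h)
  rw [Int.abs_eq_natAbs]; exact_mod_cast this

lemma step_lemma {A Q U J P : ℕ} (hU : 4 ≤ U) (hQ : 1 ≤ Q) (hA : A = Q * U) (hJ : 1 ≤ J)
    {F : TP} (hF : Good F) (hF0 : F.coeff 0 = 1) (hP : 2 * U * (tdeg F + 1) ≤ P) (l : ℤ) :
    (F * stg A Q J P).coeff l = F.coeff l ∨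
    (F.coeff l = 0 ∧ (F * stg A Q J P).coeff l ≤ 1 / J ∧
      (0 < l → ∃ j < J, NearSpec A Q U (2^j * P) l)) := by
  have hA4 : 2 ≤ A := by rw [hA]; nlinarith
  have hA1' : (1:ℤ) ≤ A := by exact_mod_cast (by omega : 1 ≤ A)
  have hU' : (4:ℤ) ≤ U := by exact_mod_cast hU
  have hPM : (P:ℤ) < (A:ℤ)^P := by exact_mod_cast (Nat.lt_pow_self (by omega) : P < A^P)
  have hP' : 2 * (U:ℤ) * (tdeg F + 1) ≤ P := by exact_mod_cast hP
  set D : ℤ := ((tdeg F : ℕ) : ℤ) with hD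
  have hD0 : 0 ≤ D := by positivity
  set M : ℤ := (A:ℤ)^P with hM
  have hUD : 2 * (U * D) + 8 ≤ M := by nlinarith
  have hUD2 : 4 * D ≤ U * D := by nlinarith
  have hFs : ∀ a, F.coeff a ≠ 0 → 2 * |a| < M := fun a ha => by
    have := tdeg_le ha
    omega
  have hGs : ∀ b, (stg A Q J P).coeff b ≠ 0 → M ∣ b := fun b hb => stg_dvd hU hQ hA hb
  by_cases h0 : (F * stg A Q J P).coeff l = 0
  · left
    have h1 := coeff_mul_ge hF (stg_good A Q J P) l 0
    rw [add_zero, stg_zero hU hQ hA hJ, mul_one, h0] at h1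
    have := hF.nn l
    linarith
  · obtain ⟨a, b, ha, hb, rfl⟩ := supp_mul h0
    rw [sep_mul hFs hGs (hFs a ha) (hGs b hb)]
    by_cases hb0 : b = 0
    · left; subst hb0; rw [stg_zero hU hQ hA hJ, mul_one, add_zero]
    · right
      obtain ⟨k1, j, hj, i, q, k2, k3, k4, k5, k6⟩ := stg_le hU hQ hA hb0 hb
      have hbM : M ≤ |b| := Int.le_of_dvd (abs_pos.2 hb0) ((dvd_abs _ _).2 (hGs b hb))
      have haD := tdeg_le ha
      have hMi : M ≤ (A:ℤ)^i := pow_le_pow_right₀ hA1' (by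
        have : P ≤ 2^j * P := Nat.le_mul_of_pos_left _ (by positivity)
        omega)
      refine ⟨?_, ?_, ?_⟩
      · by_contra hc
        have h2 := tdeg_le hc
        have h3 : |b| ≤ |a + b| + |a| := by
          have := abs_add_le (a + b) (-a)
          rw [abs_neg] at this
          simpa using this
        omega
      · have h1 := hF.coeff_le_one hF0 a
        have h2 := hF.nn a
        have h3 := (stg_good A Q J P).nn b
        nlinarith
      · intro hl
        have hqpos : 1 ≤ q := by
          by_contra hq
          have hq1 : q ≤ -1 := by
            rcases abs_cases q with h | h <;> omega
          have h1 : |b - q * (A:ℤ)^i| * 4 ≤ (A:ℤ)^i := by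
            nlinarith [abs_nonneg (b - q * (A:ℤ)^i)]
          have h2 := le_abs_self (b - q * (A:ℤ)^i)
          have h3 : q * (A:ℤ)^i ≤ -1 * (A:ℤ)^i := by
            apply mul_le_mul_of_nonneg_right hq1; positivity
          have h4 := le_abs_self a
          omega
        refine ⟨j, hj, i, q.toNat, k2, k3, by omega, ?_, ?_⟩
        · rw [abs_of_pos (by omega)] at k5; omega
        · rw [Int.toNat_of_nonneg (by omega)]
          have h1 : |a + b - q * (A:ℤ)^i| ≤ |a| + |b - q * (A:ℤ)^i| := by
            rw [add_sub_assoc]; exact abs_add_le _ _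
          have h2 : |a| * U ≤ D * U := by gcongr
          nlinarith


def Uk (β : ℕ → ℕ) (K : ℕ) : ℕ := β K ^ (K+6)
def Qk (β : ℕ → ℕ) (K : ℕ) : ℕ := β K ^ ((K+7)^2 - (K+6))
def Ak (β : ℕ → ℕ) (K : ℕ) : ℕ := β K ^ ((K+7)^2)

noncomputable def FF (β P0 : ℕ → ℕ) : ℕ → TP
  | 0 => 1
  | K+1 => FF β P0 K * stg (Ak β K) (Qk β K) (K+1)
      (P0 K + K + 1 + 2 * Uk β K * (tdeg (FF β P0 K) + 1))

noncomputable def PP (β P0 : ℕ → ℕ) (K : ℕ) : ℕ :=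
  P0 K + K + 1 + 2 * Uk β K * (tdeg (FF β P0 K) + 1)

lemma FF_succ (β P0 : ℕ → ℕ) (K : ℕ) :
    FF β P0 (K+1) = FF β P0 K * stg (Ak β K) (Qk β K) (K+1) (PP β P0 K) := rfl

lemma Ak_eq (β : ℕ → ℕ) (K : ℕ) : Ak β K = Qk β K * Uk β K := by
  unfold Ak Qk Uk
  rw [← pow_add]; congr 1
  have : K + 6 ≤ (K+7)^2 := by nlinarith
  omega


lemma Uk_ge {β : ℕ → ℕ} (hβ : ∀ K, 2 ≤ β K) (K : ℕ) : 64 * 2^K ≤ Uk β K := by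
  unfold Uk
  calc 64 * 2^K = 2^(K+6) := by ring
    _ ≤ _ := Nat.pow_le_pow_left (hβ K) _

lemma Uk_ge64 {β : ℕ → ℕ} (hβ : ∀ K, 2 ≤ β K) (K : ℕ) : 64 ≤ Uk β K := by
  have := Uk_ge hβ K
  have h2 : 1 ≤ 2^K := Nat.one_le_two_pow
  omega

lemma Qk_ge {β : ℕ → ℕ} (hβ : ∀ K, 2 ≤ β K) (K : ℕ) : 1 ≤ Qk β K := by
  have := hβ K
  unfold Qk
  exact Nat.one_le_pow _ _ (by omega)

lemma FF_good0 {β P0 : ℕ → ℕ} (hβ : ∀ K, 2 ≤ β K) (K : ℕ) : Good (FF β P0 K) ∧ (FF β P0 K).coeff 0 = 1 := by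
  induction K with
  | zero => exact ⟨Good.one, by rw [FF, tp_coeff_one]; simp⟩
  | succ K ih =>
    rw [FF_succ]
    refine ⟨ih.1.mul (stg_good _ _ _ _), ?_⟩
    have h := step_lemma (J := K+1) (P := PP β P0 K) (by have := Uk_ge64 hβ K; omega : 4 ≤ Uk β K) (Qk_ge hβ K) (Ak_eq β K) (by omega) ih.1 ih.2
      (by unfold PP; omega) 0
    rcases h with h | h
    · rw [h, ih.2]
    · rw [ih.2] at h; norm_num at h

lemma FF_step {β P0 : ℕ → ℕ} (hβ : ∀ K, 2 ≤ β K) (K : ℕ) (l : ℤ) : (FF β P0 (K+1)).coeff l = (FF β P0 K).coeff l ∨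
    ((FF β P0 K).coeff l = 0 ∧ (FF β P0 (K+1)).coeff l ≤ 1 / ((K+1:ℕ):ℝ) ∧
      (0 < l → ∃ j < K+1, NearSpec (Ak β K) (Qk β K) (Uk β K) (2^j * PP β P0 K) l)) := by
  have ih := FF_good0 (P0 := P0) hβ K
  rw [FF_succ]
  exact step_lemma (J := K+1) (P := PP β P0 K) (by have := Uk_ge64 hβ K; omega : 4 ≤ Uk β K) (Qk_ge hβ K) (Ak_eq β K) (by omega) ih.1 ih.2
      (by unfold PP; omega) l

lemma FF_factor {β P0 : ℕ → ℕ} (hβ : ∀ K, 2 ≤ β K) {K L : ℕ} (h : K ≤ L) :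
    ∃ G : TP, Good G ∧ 1 ≤ G.coeff 0 ∧ FF β P0 L = FF β P0 K * G := by
  induction L, h using Nat.le_induction with
  | base => exact ⟨1, Good.one, by rw [tp_coeff_one]; simp, by rw [mul_one]⟩
  | succ L _ ih =>
    obtain ⟨G, h1, h2, h3⟩ := ih
    refine ⟨G * stg (Ak β L) (Qk β L) (L+1) (PP β P0 L), h1.mul (stg_good _ _ _ _), ?_, ?_⟩
    · have := coeff_mul_ge h1 (stg_good (Ak β L) (Qk β L) (L+1) (PP β P0 L)) 0 0
      rw [add_zero, stg_zero (by have := Uk_ge64 hβ L; omega : 4 ≤ Uk β L) (Qk_ge hβ L) (Ak_eq β L) (by omega), mul_one] at this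
      linarith
    · rw [FF_succ, h3, mul_assoc]

lemma FF_mono {β P0 : ℕ → ℕ} (hβ : ∀ K, 2 ≤ β K) (l : ℤ) : Monotone (fun K => (FF β P0 K).coeff l) := by
  intro K L h
  obtain ⟨G, h1, h2, h3⟩ := FF_factor (P0 := P0) hβ h
  have g := (FF_good0 (P0 := P0) hβ K).1
  have := coeff_mul_ge g h1 l 0
  have h4 := g.nn l
  simp only
  rw [add_zero] at this
  rw [h3]; nlinarith

lemma FF_decay {β P0 : ℕ → ℕ} (hβ : ∀ K, 2 ≤ β K) {K0 K : ℕ} (h : K0 ≤ K) (l : ℤ) (h0 : (FF β P0 K0).coeff l = 0) :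
    (FF β P0 K).coeff l ≤ 1 / ((K0+1:ℕ):ℝ) := by
  induction K, h using Nat.le_induction with
  | base => rw [h0]; positivity
  | succ K hK ih =>
    rcases FF_step (P0 := P0) hβ K l with h | h
    · rw [h]; exact ih
    · refine h.2.1.trans ?_
      gcongr

lemma FF_count_step {β P0 : ℕ → ℕ} (hβ : ∀ K, 2 ≤ β K) (b h K : ℕ) (hb : 2 ≤ b) (hh : 1 ≤ h)
    (hcp : ∀ p ≥ P0 K, ∀ S : Finset (ℕ × ℕ), (∀ z ∈ S, z.2 < z.1 ∧
      NearSpec (Ak β K) (Qk β K) (Uk β K) p ((h:ℤ) * ((b:ℤ)^z.1 - (b:ℤ)^z.2))) →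
      ∑ z ∈ S, (1:ℝ) / (z.1:ℝ)^2 ≤ 1000 / (Uk β K : ℕ))
    (S : Finset (ℕ × ℕ)) (hS : ∀ z ∈ S, z.2 < z.1) :
    ∑ z ∈ S, (FF β P0 (K+1)).coeff ((h:ℤ) * ((b:ℤ)^z.1 - (b:ℤ)^z.2)) / (z.1:ℝ)^2 ≤
    ∑ z ∈ S, (FF β P0 K).coeff ((h:ℤ) * ((b:ℤ)^z.1 - (b:ℤ)^z.2)) / (z.1:ℝ)^2 + 1000 / (Uk β K : ℕ) := by
  classical
  set ℓ : ℕ × ℕ → ℤ := fun z => (h:ℤ) * ((b:ℤ)^z.1 - (b:ℤ)^z.2) with hℓ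
  set R : ℕ → ℕ × ℕ → Prop := fun j z => NearSpec (Ak β K) (Qk β K) (Uk β K) (2^j * PP β P0 K) (ℓ z) with hR
  have hpw : ∀ z ∈ S, (FF β P0 (K+1)).coeff (ℓ z) / (z.1:ℝ)^2 ≤ (FF β P0 K).coeff (ℓ z) / (z.1:ℝ)^2
      + ∑ j ∈ range (K+1), (1 / ((K+1:ℕ):ℝ)) * (if R j z then 1 / (z.1:ℝ)^2 else 0) := by
    intro z hz
    have hnn : ∀ j ∈ range (K+1), 0 ≤ (1 / ((K+1:ℕ):ℝ)) * (if R j z then 1 / (z.1:ℝ)^2 else 0) := by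
      intro j _; split_ifs <;> positivity
    rcases FF_step (P0 := P0) hβ K (ℓ z) with h1 | ⟨h1, h2, h3⟩
    · rw [h1]; linarith [sum_nonneg hnn]
    · have hl : 0 < ℓ z := by
        have : (b:ℤ)^z.2 < (b:ℤ)^z.1 := pow_lt_pow_right₀ (by exact_mod_cast (by omega : 1 < b)) (hS z hz)
        have hh' : (1:ℤ) ≤ h := by exact_mod_cast hh
        apply mul_pos <;> linarith
      obtain ⟨j, hj, hjR⟩ := h3 hl
      have h4 := single_le_sum hnn (mem_range.2 hj)
      rw [if_pos hjR] at h4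
      refine le_trans ?_ (add_le_add_right h4 _)
      rw [h1, zero_div, zero_add, div_eq_mul_one_div]
      gcongr
  have hj : ∀ j ∈ range (K+1), ∑ z ∈ S, (1 / ((K+1:ℕ):ℝ)) * (if R j z then 1 / (z.1:ℝ)^2 else 0)
      ≤ (1 / ((K+1:ℕ):ℝ)) * (1000 / (Uk β K : ℕ)) := by
    intro j _
    rw [← mul_sum, ← sum_filter]
    gcongr
    apply hcp (2^j * PP β P0 K)
    · have : PP β P0 K ≤ 2^j * PP β P0 K := Nat.le_mul_of_pos_left _ (by positivity)
      have h2 : P0 K ≤ PP β P0 K := by unfold PP; omega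
      omega
    · intro z hz
      rw [Finset.mem_filter] at hz
      exact ⟨hS z hz.1, hz.2⟩
  refine (sum_le_sum hpw).trans ?_
  rw [sum_add_distrib, sum_comm]
  gcongr
  refine (sum_le_sum hj).trans ?_
  rw [sum_const, card_range, nsmul_eq_mul, ← mul_assoc]
  have : ((K+1:ℕ):ℝ) * (1 / ((K+1:ℕ):ℝ)) = 1 := by field_simp
  rw [this, one_mul]

lemma FF_count {β P0 : ℕ → ℕ} (hβ : ∀ K, 2 ≤ β K) (b h K0 : ℕ) (hb : 2 ≤ b) (hh : 1 ≤ h)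
    (hcp : ∀ K ≥ K0, ∀ p ≥ P0 K, ∀ S : Finset (ℕ × ℕ), (∀ z ∈ S, z.2 < z.1 ∧
      NearSpec (Ak β K) (Qk β K) (Uk β K) p ((h:ℤ) * ((b:ℤ)^z.1 - (b:ℤ)^z.2))) →
      ∑ z ∈ S, (1:ℝ) / (z.1:ℝ)^2 ≤ 1000 / (Uk β K : ℕ))
    (S : Finset (ℕ × ℕ)) (hS : ∀ z ∈ S, z.2 < z.1) (K : ℕ) (hK : K0 ≤ K) :
    ∑ z ∈ S, (FF β P0 K).coeff ((h:ℤ) * ((b:ℤ)^z.1 - (b:ℤ)^z.2)) / (z.1:ℝ)^2 ≤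
      ((tdeg (FF β P0 K0) : ℝ) + 1)^2 + 2000 := by
  have hmain : ∀ K, K0 ≤ K → ∑ z ∈ S, (FF β P0 K).coeff ((h:ℤ) * ((b:ℤ)^z.1 - (b:ℤ)^z.2)) / (z.1:ℝ)^2 ≤
      ((tdeg (FF β P0 K0) : ℝ) + 1)^2 + 2000 - 2000 / 2^K := by
    intro K hK
    induction K, hK using Nat.le_induction with
    | base =>
      set D := tdeg (FF β P0 K0) with hD
      obtain ⟨g, g0⟩ := FF_good0 (P0 := P0) hβ K0
      have hpw : ∀ z ∈ S, (FF β P0 K0).coeff ((h:ℤ) * ((b:ℤ)^z.1 - (b:ℤ)^z.2)) / (z.1:ℝ)^2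
          ≤ if z ∈ range (D+1) ×ˢ range (D+1) then 1 else 0 := by
        intro z hz
        have hz1 := hS z hz
        by_cases hc : (FF β P0 K0).coeff ((h:ℤ) * ((b:ℤ)^z.1 - (b:ℤ)^z.2)) = 0
        · rw [hc, zero_div]; split_ifs <;> norm_num
        · have h1 := tdeg_le hc
          have h2 : (z.1:ℤ) ≤ (h:ℤ) * ((b:ℤ)^z.1 - (b:ℤ)^z.2) := by
            obtain ⟨n, hn⟩ : ∃ n, z.1 = n + 1 := ⟨z.1 - 1, by omega⟩
            have e1 : (b:ℤ)^z.2 ≤ (b:ℤ)^n := pow_le_pow_right₀ (by exact_mod_cast (by omega : 1 ≤ b)) (by omega)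
            have e2 : (n:ℤ) < (b:ℤ)^n := by exact_mod_cast (Nat.lt_pow_self (by omega) : n < b^n)
            have hb' : (2:ℤ) ≤ b := by exact_mod_cast hb
            have hh' : (1:ℤ) ≤ h := by exact_mod_cast hh
            rw [hn, pow_succ]
            push_cast
            have e3 : (b:ℤ)^n * 2 ≤ (b:ℤ)^n * b := by gcongr
            have e4 : (n:ℤ) + 1 ≤ (b:ℤ)^n * b - (b:ℤ)^z.2 := by linarith
            nlinarith
          have h3 := le_abs_self ((h:ℤ) * ((b:ℤ)^z.1 - (b:ℤ)^z.2))
          have h4 : (z.1:ℤ) ≤ D := by linarith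
          rw [if_pos (by simp only [mem_product, mem_range]; omega)]
          have h5 := g.coeff_le_one g0 ((h:ℤ) * ((b:ℤ)^z.1 - (b:ℤ)^z.2))
          have h6 : (1:ℝ) ≤ (z.1:ℝ)^2 := by
            have : 1 ≤ z.1 := by omega
            exact_mod_cast Nat.one_le_pow _ _ this
          rw [div_le_one (by linarith)]; linarith
      refine (sum_le_sum hpw).trans ?_
      rw [← sum_filter, sum_const, nsmul_eq_mul, mul_one]
      have h7 : (S.filter fun z => z ∈ range (D+1) ×ˢ range (D+1)).card ≤ (D+1)^2 := by
        refine (card_le_card (t := range (D+1) ×ˢ range (D+1)) ?_).trans ?_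
        · intro z hz; rw [Finset.mem_filter] at hz; exact hz.2
        · rw [card_product, card_range, sq]
      have h8 : ((S.filter fun z => z ∈ range (D+1) ×ˢ range (D+1)).card : ℝ) ≤ ((D:ℝ)+1)^2 := by exact_mod_cast h7
      have h9 : (2000:ℝ) / 2^K0 ≤ 2000 := by
        apply div_le_self (by norm_num); exact one_le_pow₀ (by norm_num)
      linarith
    | succ K hK ih =>
      refine (FF_count_step hβ b h K hb hh (hcp K hK) S hS).trans ?_
      have h1 : (64:ℝ) * 2^K ≤ (Uk β K : ℕ) := by exact_mod_cast Uk_ge hβ K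
      have h2 : (1000:ℝ) / (Uk β K : ℕ) ≤ 1000 / 2^K := by
        have : (0:ℝ) < 2^K := by positivity
        gcongr; linarith
      have h3 : (2000:ℝ) / 2^(K+1) = 2000 / 2^K - 1000 / 2^K := by
        rw [pow_succ]; field_simp; norm_num
      linarith
  refine (hmain K hK).trans ?_
  have : (0:ℝ) ≤ 2000 / 2^K := by positivity
  linarith



lemma exists_limit {β P0 : ℕ → ℕ} (hβ : ∀ K, 2 ≤ β K) : ∃ μ : Measure ℝ, IsProbabilityMeasure μ ∧
    (∀ l : ℤ, Tendsto (fun K => (((FF β P0 K).coeff l : ℝ) : ℂ)) atTop (nhds (muHat μ l))) ∧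
    (∀ G : Set ℝ, IsOpen G → ∀ c : ENNReal, (∀ᶠ L in atTop, muF (FF β P0 L) G ≤ c) → μ G ≤ c) := by
  have hp : ∀ K, IsProbabilityMeasure (muF (FF β P0 K)) := fun K =>
    (FF_good0 hβ K).1.muF_prob (FF_good0 hβ K).2
  set m : ℕ → ProbabilityMeasure ℝ := fun K => ⟨muF (FF β P0 K), hp K⟩ with hm
  have htight : IsTightMeasureSet {((μ : ProbabilityMeasure ℝ) : Measure ℝ) | μ ∈ Set.range m} := by
    rw [isTightMeasureSet_iff_exists_isCompact_measure_compl_le]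
    intro ε hε
    refine ⟨Set.Icc 0 1, isCompact_Icc, ?_⟩
    rintro _ ⟨_, ⟨K, rfl⟩, rfl⟩
    have : muF (FF β P0 K) (Set.Icc (0:ℝ) 1)ᶜ = 0 := by
      apply withDensity_absolutelyContinuous
      rw [Measure.restrict_apply measurableSet_Icc.compl]
      convert measure_empty (μ := (volume : Measure ℝ))
      ext x
      simp only [Set.mem_inter_iff, Set.mem_compl_iff, Set.mem_Icc, Set.mem_Ico, Set.mem_empty_iff_false, iff_false]
      rintro ⟨h1, h2⟩; exact h1 ⟨h2.1, h2.2.le⟩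
    change muF (FF β P0 K) (Set.Icc (0:ℝ) 1)ᶜ ≤ ε
    rw [this]; exact hε.le
  have hcomp := isCompact_closure_of_isTightMeasureSet htight
  set U : Ultrafilter ℕ := Ultrafilter.of atTop with hU
  have hUle : (U : Filter ℕ) ≤ atTop := Ultrafilter.of_le atTop
  obtain ⟨ν, -, hν⟩ := hcomp.ultrafilter_le_nhds (U.map m) (by
    rw [le_principal_iff]
    change ∀ᶠ K in (U : Filter ℕ), m K ∈ closure (Set.range m)
    exact Eventually.of_forall fun K => subset_closure ⟨K, rfl⟩)
  have ht : Tendsto m (U : Filter ℕ) (nhds ν) := hν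
  refine ⟨ν, inferInstance, ?_, ?_⟩
  · intro l
    have h1 := (ProbabilityMeasure.tendsto_iff_forall_integral_rclike_tendsto ℂ).1 ht
      (BoundedContinuousFunction.ofNormedAddCommGroup (fun x => eneg ((l:ℝ) * x))
        (eneg_cont.comp (continuous_const.mul continuous_id)) 1 (fun x => (eneg_norm _).le))
    have h2 : Tendsto (fun K => (((FF β P0 K).coeff l : ℝ) : ℂ)) (U : Filter ℕ) (nhds (muHat ν l)) := by
      refine Tendsto.congr (fun K => ?_) h1
      rw [← (FF_good0 hβ K).1.muHat_muF]
      rfl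
    have h3 : Tendsto (fun K => (FF β P0 K).coeff l) atTop (nhds (⨆ K, (FF β P0 K).coeff l)) := by
      apply tendsto_atTop_ciSup (FF_mono hβ l)
      exact ⟨1, by rintro _ ⟨K, rfl⟩; exact (FF_good0 hβ K).1.coeff_le_one (FF_good0 hβ K).2 l⟩
    have h4 : Tendsto (fun K => (((FF β P0 K).coeff l : ℝ) : ℂ)) atTop (nhds ((⨆ K, (FF β P0 K).coeff l : ℝ) : ℂ)) :=
      (Complex.continuous_ofReal.tendsto _).comp h3
    have h5 := tendsto_nhds_unique h2 (h4.mono_left hUle)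
    rw [h5]; exact h4
  · intro G hG c hc
    refine (ProbabilityMeasure.le_liminf_measure_open_of_tendsto ht hG).trans ?_
    have hc2 : ∀ᶠ L in (U : Filter ℕ), (m L : Measure ℝ) G ≤ c := hc.filter_mono hUle
    refine liminf_le_of_frequently_le hc2.frequently ?_
    isBoundedDefault

lemma limit_rajchman {β P0 : ℕ → ℕ} (hβ : ∀ K, 2 ≤ β K) {μ : Measure ℝ}
    (hμ : ∀ l : ℤ, Tendsto (fun K => (((FF β P0 K).coeff l : ℝ) : ℂ)) atTop (nhds (muHat μ l))) :
    Rajchman μ := by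
  unfold Rajchman
  rw [Metric.tendsto_nhds]
  intro ε hε
  obtain ⟨K0, hK0⟩ := exists_nat_one_div_lt hε
  refine (Finset.finite_toSet (FF β P0 K0).coeff.support).subset ?_
  intro l hl
  by_contra hc
  apply hl
  have h0 : (FF β P0 K0).coeff l = 0 := by
    rw [Finset.mem_coe, Finsupp.mem_support_iff, not_not] at hc; exact hc
  change dist (muHat μ l) 0 < ε
  rw [dist_zero_right]
  refine lt_of_le_of_lt (le_of_tendsto (hμ l).norm ?_) hK0
  filter_upwards [eventually_ge_atTop K0] with K hK
  rw [Complex.norm_real, Real.norm_eq_abs, abs_of_nonneg ((FF_good0 hβ K).1.nn l)]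
  have := FF_decay (P0 := P0) hβ hK l h0
  push_cast at this; exact this

lemma limit_normal {β P0 : ℕ → ℕ} (hβ : ∀ K, 2 ≤ β K) {μ : Measure ℝ} [IsProbabilityMeasure μ]
    (hμ : ∀ l : ℤ, Tendsto (fun K => (((FF β P0 K).coeff l : ℝ) : ℂ)) atTop (nhds (muHat μ l)))
    (b : ℕ) (hb : 2 ≤ b)
    (hcp : ∀ h : ℕ, 1 ≤ h → ∃ K0, ∀ K ≥ K0, ∀ p ≥ P0 K, ∀ S : Finset (ℕ × ℕ), (∀ z ∈ S, z.2 < z.1 ∧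
      NearSpec (Ak β K) (Qk β K) (Uk β K) p ((h:ℤ) * ((b:ℤ)^z.1 - (b:ℤ)^z.2))) →
      ∑ z ∈ S, (1:ℝ) / (z.1:ℝ)^2 ≤ 1000 / (Uk β K : ℕ)) :
    ∀ᵐ x ∂μ, IsNormal b x := by
  have : ∀ᵐ x ∂μ, ∀ h : ℕ, 1 ≤ h →
      Tendsto (fun N => (∑ n∈range N, eneg (h*(b:ℝ)^n*x))/(N:ℂ)) atTop (nhds 0) := by
    rw [ae_all_iff]
    intro h
    by_cases hh : 1 ≤ h
    · obtain ⟨K0, hK0⟩ := hcp h hh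
      have := weyl_ae μ h b (((tdeg (FF β P0 K0) : ℝ) + 1)^2 + 2000) (by
        intro S hS
        have ht : Tendsto (fun K => ∑ z ∈ S, (FF β P0 K).coeff ((h:ℤ) * ((b:ℤ)^z.1 - (b:ℤ)^z.2)) / (z.1:ℝ)^2)
            atTop (nhds (∑ z∈S, ‖muHat μ ((h:ℤ)*((b:ℤ)^z.1-(b:ℤ)^z.2))‖/(z.1:ℝ)^2)) := by
          apply tendsto_finsetSum
          intro z _
          apply Tendsto.div_const
          refine Tendsto.congr (fun K => ?_) (hμ ((h:ℤ) * ((b:ℤ)^z.1 - (b:ℤ)^z.2))).norm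
          rw [Complex.norm_real, Real.norm_eq_abs, abs_of_nonneg ((FF_good0 hβ K).1.nn _)]
        apply le_of_tendsto ht
        filter_upwards [eventually_ge_atTop K0] with K hK
        exact FF_count hβ b h K0 hb hh hK0 S hS K hK)
      filter_upwards [this] with x hx _ using hx
    · exact Eventually.of_forall fun x hc => absurd hc hh
  filter_upwards [this] with x hx
  exact weyl_normal b hb x hx


noncomputable def ZZ (β N : ℕ) (x : ℝ) : ℝ :=
  (1 / (N:ℝ)) * ∑ n ∈ range N, (eneg ((((β:ℤ)^(N+n) : ℤ) : ℝ) * x)).re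

lemma ZZ_cont (β N : ℕ) : Continuous (ZZ β N) := by
  unfold ZZ
  refine continuous_const.mul (continuous_finsetSum _ fun n _ => ?_)
  exact Complex.continuous_re.comp (eneg_cont.comp (continuous_const.mul continuous_id))

lemma int_re {H : TP} (hH : Good H) (l : ℤ) :
    ∫ x in Set.Ico (0:ℝ) 1, (eneg ((l:ℝ) * x)).re * tdens H x = H.coeff l := by
  have h := integral_ev H l
  have hc : Continuous fun x : ℝ => eneg ((l:ℝ) * x) * ev x H :=
    (eneg_cont.comp (continuous_const.mul continuous_id)).mul (ev_cont H)
  have h2 := integral_re (cont_intOnC _ hc)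
  rw [h] at h2
  simp only [RCLike.re_eq_complex_re, Complex.ofReal_re] at h2
  rw [← h2]
  congr 1
  ext x
  rw [hH.dens_eq, Complex.re_mul_ofReal]

lemma bad_int {H : TP} (hH : Good H) (β N : ℕ) {S : Set ℝ} (hS : MeasurableSet S)
    (hSZ : ∀ x ∈ S, ZZ β N x < 1/2) :
    ∫ x in Set.Ico (0:ℝ) 1, S.indicator (tdens H) x ≤
      2 * (H.coeff 0 - (1 / (N:ℝ)) * ∑ n ∈ range N, H.coeff ((β:ℤ)^(N+n))) := by
  have hone : ∀ x, ZZ β N x ≤ 1 := by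
    intro x
    unfold ZZ
    have h1 : ∑ n ∈ range N, (eneg ((((β:ℤ)^(N+n) : ℤ) : ℝ) * x)).re ≤ ∑ n ∈ range N, (1:ℝ) := by
      apply sum_le_sum
      intro n _
      exact (Complex.re_le_norm _).trans (eneg_norm _).le
    rw [sum_const, card_range, nsmul_eq_mul, mul_one] at h1
    rcases Nat.eq_zero_or_pos N with h | h
    · subst h; simp
    · have : (0:ℝ) < N := by exact_mod_cast h
      calc _ ≤ (1 / (N:ℝ)) * N := by gcongr
        _ = 1 := by field_simp
  have hI : ∫ x in Set.Ico (0:ℝ) 1, 2 * (tdens H x - (1 / (N:ℝ)) * ∑ n ∈ range N, (eneg ((((β:ℤ)^(N+n) : ℤ) : ℝ) * x)).re * tdens H x)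
      = 2 * (H.coeff 0 - (1 / (N:ℝ)) * ∑ n ∈ range N, H.coeff ((β:ℤ)^(N+n))) := by
    have hc : ∀ n, Continuous fun x : ℝ => (eneg ((((β:ℤ)^(N+n) : ℤ) : ℝ) * x)).re * tdens H x := fun n =>
      (Complex.continuous_re.comp (eneg_cont.comp (continuous_const.mul continuous_id))).mul (dens_cont H)
    rw [integral_const_mul, integral_sub, integral_const_mul, integral_finsetSum, hH.integral_dens]
    · simp_rw [int_re hH]
    · intro n _; exact cont_intOn _ (hc n)
    · exact cont_intOn _ (dens_cont H)
    · exact cont_intOn _ (continuous_const.mul (continuous_finsetSum _ fun n _ => hc n))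
  rw [← hI]
  have hc : ∀ n, Continuous fun x : ℝ => (eneg ((((β:ℤ)^(N+n) : ℤ) : ℝ) * x)).re * tdens H x := fun n =>
      (Complex.continuous_re.comp (eneg_cont.comp (continuous_const.mul continuous_id))).mul (dens_cont H)
  apply integral_mono
  · exact (cont_intOn _ (dens_cont H)).indicator hS
  · exact cont_intOn _ (continuous_const.mul ((dens_cont H).sub (continuous_const.mul (continuous_finsetSum _ fun n _ => hc n))))
  · intro x
    have e : 2 * (tdens H x - (1 / (N:ℝ)) * ∑ n ∈ range N, (eneg ((((β:ℤ)^(N+n) : ℤ) : ℝ) * x)).re * tdens H x)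
        = 2 * (1 - ZZ β N x) * tdens H x := by
      rw [← sum_mul]; unfold ZZ; ring
    simp only
    rw [e]
    have hd := hH.dens_nonneg x
    by_cases hx : x ∈ S
    · rw [Set.indicator_of_mem hx]
      have := hSZ x hx
      nlinarith
    · rw [Set.indicator_of_notMem hx]
      have := hone x
      apply mul_nonneg _ hd
      linarith

lemma block_sum (f : ℕ → ℝ) (s : ℕ) (c : ℝ) (p : ℕ)
    (h : ∀ i < p, c ≤ ∑ k ∈ range s, f (s * i + k)) : p * c ≤ ∑ n ∈ range (s * p), f n := by
  induction p with
  | zero => simp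
  | succ p ih =>
    have h1 := ih (fun i hi => h i (by omega))
    have h2 := h p (by omega)
    rw [mul_add, mul_one, sum_range_add]
    push_cast
    linarith

lemma geomN_le (β : ℕ) (hβ : 2 ≤ β) (m : ℕ) : ∑ k ∈ range m, (β:ℝ)^k ≤ (β:ℝ)^m := by
  have hb : (2:ℝ) ≤ β := by exact_mod_cast hβ
  induction m with
  | zero => simp
  | succ m ih =>
    rw [sum_range_succ, pow_succ]
    have : (0:ℝ) < (β:ℝ)^m := by positivity
    nlinarith

lemma avg_lower {H : TP} (hH : Good H) {β s m p : ℕ} (hβ : 2 ≤ β) (hms : m ≤ s) (hm : 1 ≤ m) (hp : 1 ≤ p)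
    (hl : ∀ i < p, ∀ k < m, 1 - (β:ℝ)^k / (β:ℝ)^m ≤ H.coeff ((β:ℤ)^(s * p + (s * i + k)))) :
    ((m:ℝ) - 1) / s ≤ (1 / ((s * p : ℕ):ℝ)) * ∑ n ∈ range (s * p), H.coeff ((β:ℤ)^(s * p + n)) := by
  have h1 := block_sum (fun n => H.coeff ((β:ℤ)^(s * p + n))) s ((m:ℝ) - 1) p (by
    intro i hi
    have hsub : range m ⊆ range s := range_subset_range.2 hms
    calc (m:ℝ) - 1 ≤ ∑ k ∈ range m, (1 - (β:ℝ)^k / (β:ℝ)^m) := by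
          rw [sum_sub_distrib, ← sum_div]
          simp only [sum_const, card_range, nsmul_eq_mul, mul_one]
          have hpos : (0:ℝ) < (β:ℝ)^m := by
            have : (0:ℝ) < β := by exact_mod_cast (by omega : 0 < β)
            positivity
          have : (∑ k ∈ range m, (β:ℝ)^k) / (β:ℝ)^m ≤ 1 := by
            rw [div_le_one hpos]; exact geomN_le β hβ m
          linarith
      _ ≤ ∑ k ∈ range m, H.coeff ((β:ℤ)^(s * p + (s * i + k))) := by
          apply sum_le_sum
          intro k hk
          exact hl i hi k (mem_range.1 hk)
      _ ≤ ∑ k ∈ range s, H.coeff ((β:ℤ)^(s * p + (s * i + k))) :=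
          sum_le_sum_of_subset_of_nonneg hsub fun k _ _ => hH.nn _)
  have hs : (0:ℝ) < s := by exact_mod_cast (by omega : 0 < s)
  have hp' : (0:ℝ) < p := by exact_mod_cast (by omega : 0 < p)
  calc ((m:ℝ) - 1) / s = (1 / ((s * p : ℕ):ℝ)) * (p * ((m:ℝ) - 1)) := by
        push_cast; field_simp
    _ ≤ _ := by gcongr


def badset (β P0 : ℕ → ℕ) (K : ℕ) : Set ℝ :=
  ⋂ j ∈ range (K+1), {x | ZZ (β K) ((K+7)^2 * (2^j * PP β P0 K)) x < 1/2}

lemma badset_open (β P0 : ℕ → ℕ) (K : ℕ) : IsOpen (badset β P0 K) := by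
  unfold badset
  apply isOpen_biInter_finset
  intro j _
  exact isOpen_lt (ZZ_cont _ _) continuous_const

lemma ZZ_fract (b N : ℕ) (x : ℝ) : ZZ b N (Int.fract x) = ZZ b N x := by
  unfold ZZ
  congr 1
  apply sum_congr rfl
  intro n _
  congr 1
  have : (((b:ℤ)^(N+n) : ℤ) : ℝ) * Int.fract x = (((b:ℤ)^(N+n) : ℤ) : ℝ) * x - (((b:ℤ)^(N+n) * ⌊x⌋ : ℤ) : ℝ) := by
    rw [Int.fract]; push_cast; ring
  rw [this, eneg_sub_int]

lemma badset_fract (β P0 : ℕ → ℕ) (K : ℕ) (x : ℝ) :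
    Int.fract x ∈ badset β P0 K ↔ x ∈ badset β P0 K := by
  unfold badset
  simp only [Set.mem_iInter]
  refine forall₂_congr fun j _ => ?_
  change ZZ _ _ (Int.fract x) < 1/2 ↔ ZZ _ _ x < 1/2
  rw [ZZ_fract]


lemma badset_small {β P0 : ℕ → ℕ} (hβ : ∀ K, 2 ≤ β K) (K L : ℕ) (hL : K + 1 ≤ L) :
    muF (FF β P0 L) (badset β P0 K) ≤ ENNReal.ofReal (2 / ((K:ℝ) + 7)) := by
  obtain ⟨G, hG, hG0, hGe⟩ := FF_factor (P0 := P0) hβ hL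
  obtain ⟨gK, gK0⟩ := FF_good0 (P0 := P0) hβ K
  obtain ⟨gL, gL0⟩ := FF_good0 (P0 := P0) hβ L
  have hJ : (0:ℝ) < ((K+1:ℕ):ℝ) := by positivity
  set H : ℕ → TP := fun j => FF β P0 K * rp (Ak β K) (Qk β K) (2^j * PP β P0 K) (2^j * PP β P0 K) * G with hH
  have hHg : ∀ j, Good (H j) := fun j => (gK.mul (rp_good _ _ _ _)).mul hG
  have hdec : FF β P0 L = (1 / ((K+1:ℕ):ℝ)) • ∑ j ∈ range (K+1), H j := by
    rw [hGe, FF_succ, hH]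
    unfold stg
    rw [mul_smul_comm, smul_mul_assoc, mul_sum, sum_mul]
  have hco : ∀ l, (FF β P0 L).coeff l = (1 / ((K+1:ℕ):ℝ)) * ∑ j ∈ range (K+1), (H j).coeff l := by
    intro l
    rw [hdec, AddMonoidAlgebra.coeff_smul_apply, tp_coeff_sum, smul_eq_mul]
  have hden : ∀ x, tdens (FF β P0 L) x = (1 / ((K+1:ℕ):ℝ)) * ∑ j ∈ range (K+1), tdens (H j) x := by
    intro x
    unfold tdens
    rw [hdec, map_smul, map_sum, Complex.smul_re, Complex.re_sum, smul_eq_mul]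
  have hS := (badset_open β P0 K).measurableSet
  rw [gL.muF_apply hS]
  apply ENNReal.ofReal_le_ofReal
  have hind : ∀ x, (badset β P0 K).indicator (tdens (FF β P0 L)) x
      = (1 / ((K+1:ℕ):ℝ)) * ∑ j ∈ range (K+1), (badset β P0 K).indicator (tdens (H j)) x := by
    intro x
    by_cases hx : x ∈ badset β P0 K
    · simp only [Set.indicator_of_mem hx]; exact hden x
    · simp only [Set.indicator_of_notMem hx]; simp
  simp_rw [hind]
  rw [integral_const_mul, integral_finsetSum _ (fun j _ => (cont_intOn _ (dens_cont (H j))).indicator hS)]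
  have hPP : 1 ≤ PP β P0 K := by unfold PP; omega
  have hum : K + 6 ≤ (K+7)^2 := by nlinarith
  have hj : ∀ j ∈ range (K+1), ∫ x in Set.Ico (0:ℝ) 1, (badset β P0 K).indicator (tdens (H j)) x
      ≤ 2 * ((H j).coeff 0 - (((((K+7)^2 - (K+6) : ℕ):ℝ) - 1) / (((K+7)^2 : ℕ):ℝ))) := by
    intro j hj
    have hp : 1 ≤ 2^j * PP β P0 K := Nat.mul_pos (by positivity) hPP
    refine (bad_int (hHg j) (β K) ((K+7)^2 * (2^j * PP β P0 K)) hS ?_).trans ?_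
    · intro x hx
      unfold badset at hx
      exact Set.mem_iInter₂.1 hx j hj
    · have := avg_lower (hHg j) (β := β K) (s := (K+7)^2) (m := (K+7)^2 - (K+6)) (p := 2^j * PP β P0 K)
        (hβ K) (by omega) (by have : K + 7 ≤ (K+7)^2 := by nlinarith
                              omega) hp (by
          intro i hi k hk
          have hβK := hβ K
          have hQ := Qk_ge hβ K
          have hA : 1 ≤ Ak β K := by unfold Ak; exact Nat.one_le_pow _ _ (by omega)
          have hkQ : (β K)^k ≤ Qk β K := Nat.pow_le_pow_right (by omega) hk.le
          have h1 := rp_lower (p := 2^j * PP β P0 K) hA hQ hi hkQ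
          have e : (Ak β K : ℤ)^(2^j * PP β P0 K + i) * ((β K ^ k : ℕ) : ℤ)
              = (β K : ℤ)^((K+7)^2 * (2^j * PP β P0 K) + ((K+7)^2 * i + k)) := by
            unfold Ak; push_cast; rw [← pow_mul, ← pow_add]; congr 1; ring
          rw [e] at h1
          set l : ℤ := (β K : ℤ)^((K+7)^2 * (2^j * PP β P0 K) + ((K+7)^2 * i + k))
          have h2 := coeff_mul_ge gK (rp_good (Ak β K) (Qk β K) (2^j * PP β P0 K) (2^j * PP β P0 K)) 0 l
          have h3 := coeff_mul_ge (gK.mul (rp_good (Ak β K) (Qk β K) (2^j * PP β P0 K) (2^j * PP β P0 K))) hG l 0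
          rw [zero_add, gK0, one_mul] at h2
          rw [add_zero] at h3
          have h4 := (gK.mul (rp_good (Ak β K) (Qk β K) (2^j * PP β P0 K) (2^j * PP β P0 K))).nn l
          have h5 : 1 - (β K:ℝ)^k / (β K:ℝ)^((K+7)^2 - (K+6)) = 1 - ((β K ^ k : ℕ) : ℝ) / (Qk β K : ℕ) := by
            unfold Qk; push_cast; rfl
          rw [h5]
          refine h1.trans (h2.trans (le_trans ?_ h3))
          nlinarith)
      linarith
  have hsum := hco 0
  rw [gL0] at hsum
  calc _ ≤ (1 / ((K+1:ℕ):ℝ)) * ∑ j ∈ range (K+1), 2 * ((H j).coeff 0 - (((((K+7)^2 - (K+6) : ℕ):ℝ) - 1) / (((K+7)^2 : ℕ):ℝ))) := by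
        gcongr with j hj'
        exact hj j hj'
    _ = 2 * (1 / ((K+1:ℕ):ℝ) * ∑ j ∈ range (K+1), (H j).coeff 0) - 2 * (((((K+7)^2 - (K+6) : ℕ):ℝ) - 1) / (((K+7)^2 : ℕ):ℝ)) := by
        rw [← mul_sum, sum_sub_distrib, sum_const, card_range, nsmul_eq_mul]
        field_simp
    _ = 2 / ((K:ℝ) + 7) := by
        rw [← hsum, Nat.cast_sub hum]
        push_cast
        field_simp
        ring

lemma limit_nonnormal {β P0 : ℕ → ℕ} (hβ : ∀ K, 2 ≤ β K) {μ : Measure ℝ}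
    (hμ : ∀ G : Set ℝ, IsOpen G → (∀ x, Int.fract x ∈ G ↔ x ∈ G) → ∀ c : ENNReal, (∀ᶠ L in atTop, muF (FF β P0 L) G ≤ c) → μ G ≤ c)
    (b : ℕ) (hb : 2 ≤ b) (hinf : ∀ n, ∃ K ≥ n, β K = b) :
    ∀ᵐ x ∂μ, ¬ IsNormal b x := by
  have hbad : ∀ K, μ (badset β P0 K) ≤ ENNReal.ofReal (2 / ((K:ℝ) + 7)) := fun K =>
    hμ _ (badset_open _ _ _) (badset_fract _ _ _) _ (by
      filter_upwards [eventually_ge_atTop (K+1)] with L hL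
      exact badset_small hβ K L hL)
  have hE : ∀ N0 : ℕ, μ {x | ∀ N ≥ N0, ZZ b N x < 1/2} = 0 := by
    intro N0
    apply le_antisymm _ bot_le
    have ht : Tendsto (fun n : ℕ => ENNReal.ofReal (2 / ((n:ℝ) + 7))) atTop (nhds 0) := by
      rw [← ENNReal.ofReal_zero]
      apply (ENNReal.continuous_ofReal.tendsto 0).comp
      apply Tendsto.div_atTop tendsto_const_nhds
      exact tendsto_atTop_add_const_right _ _ tendsto_natCast_atTop_atTop
    apply ge_of_tendsto ht
    filter_upwards [eventually_ge_atTop N0] with n hn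
    obtain ⟨K, hK, hKb⟩ := hinf n
    calc μ {x | ∀ N ≥ N0, ZZ b N x < 1/2} ≤ μ (badset β P0 K) := by
          apply measure_mono
          intro x hx
          unfold badset
          rw [Set.mem_iInter₂]
          intro j _
          change ZZ (β K) _ x < 1/2
          rw [hKb]
          apply hx
          have h1 : K ≤ PP β P0 K := by unfold PP; omega
          have h2 : PP β P0 K ≤ 2^j * PP β P0 K := Nat.le_mul_of_pos_left _ (by positivity)
          have h3 : 2^j * PP β P0 K ≤ (K+7)^2 * (2^j * PP β P0 K) := Nat.le_mul_of_pos_left _ (by positivity)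
          omega
      _ ≤ _ := hbad K
      _ ≤ _ := by
          apply ENNReal.ofReal_le_ofReal
          have : (n:ℝ) ≤ K := by exact_mod_cast hK
          gcongr
  have hU : μ (⋃ N0 : ℕ, {x | ∀ N ≥ N0, ZZ b N x < 1/2}) = 0 := measure_iUnion_null hE
  refine measure_mono_null ?_ hU
  intro x hx
  have hn : IsNormal b x := not_not.1 hx
  have ht := normal_weyl b hb x hn
  set T : ℕ → ℂ := fun N => ∑ n∈range N, eneg ((b:ℝ)^n*x) with hT
  have ht2 : Tendsto (fun N : ℕ => 2 * (T (2*N) / ((2*N:ℕ):ℂ)) - T N / (N:ℂ)) atTop (nhds (2 * 0 - 0)) := by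
    apply Tendsto.sub _ ht
    apply Tendsto.const_mul
    exact ht.comp (tendsto_id.const_mul_atTop' (by norm_num : 0 < 2))
  have ht3 : Tendsto (fun N => ZZ b N x) atTop (nhds 0) := by
    have := (Complex.continuous_re.tendsto _).comp ht2
    simp only [mul_zero, sub_zero, Complex.zero_re] at this
    refine Tendsto.congr' ?_ this
    filter_upwards [eventually_gt_atTop 0] with N hN
    have hN' : (N:ℂ) ≠ 0 := by exact_mod_cast hN.ne'
    have e : 2 * (T (2*N) / ((2*N:ℕ):ℂ)) - T N / (N:ℂ) = ((1 / (N:ℝ) : ℝ) : ℂ) * ∑ n ∈ range N, eneg ((((b:ℤ)^(N+n) : ℤ) : ℝ) * x) := by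
      have : T (2*N) = T N + ∑ n ∈ range N, eneg ((((b:ℤ)^(N+n) : ℤ) : ℝ) * x) := by
        simp only [hT]
        rw [two_mul, sum_range_add]
        push_cast; rfl
      rw [this]; push_cast; field_simp; ring
    simp only [Function.comp]
    rw [e, Complex.re_ofReal_mul, Complex.re_sum]; rfl
  have hev := (ht3.eventually (gt_mem_nhds (by norm_num : (0:ℝ) < 1/2)))
  obtain ⟨N0, hN0⟩ := eventually_atTop.1 hev
  exact Set.mem_iUnion.2 ⟨N0, hN0⟩


lemma muHat_map_fract (μ : Measure ℝ) (l : ℤ) : muHat (μ.map Int.fract) l = muHat μ l := by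
  unfold muHat
  rw [integral_map measurable_fract.aemeasurable]
  · congr 1
    ext x
    have : (l:ℝ) * Int.fract x = (l:ℝ) * x - ((l * ⌊x⌋ : ℤ) : ℝ) := by
      rw [Int.fract]; push_cast; ring
    rw [this, eneg_sub_int]
  · exact (eneg_cont.comp (continuous_const.mul continuous_id)).aestronglyMeasurable

theorem construct (B B' : Set ℕ) (hB : ∀ b ∈ B, 2 ≤ b) (hB' : ∀ b ∈ B', 2 ≤ b) (hne : B'.Nonempty)
    (hcompat : ∀ b ∈ B, ∀ b' ∈ B', Irrational (Real.log b / Real.log b')) :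
    ∃ μ : Measure ℝ, IsProbabilityMeasure μ ∧ μ ((Set.Ico (0:ℝ) 1)ᶜ) = 0 ∧ Rajchman μ ∧
      ∀ᵐ x ∂μ, (∀ b ∈ B, IsNormal b x) ∧ (∀ b' ∈ B', ¬ IsNormal b' x) := by
  classical
  obtain ⟨b0, hb0⟩ := hne
  set β : ℕ → ℕ := fun K => if (Nat.unpair K).1 ∈ B' then (Nat.unpair K).1 else b0 with hβd
  have hβB : ∀ K, β K ∈ B' := by
    intro K
    simp only [hβd]
    split_ifs with h
    · exact h
    · exact hb0
  have hβ : ∀ K, 2 ≤ β K := fun K => hB' _ (hβB K)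
  have hinf : ∀ b ∈ B', ∀ n, ∃ K ≥ n, β K = b := by
    intro b hb n
    refine ⟨Nat.pair b n, Nat.right_le_pair b n, ?_⟩
    simp only [hβd, Nat.unpair_pair]
    rw [if_pos hb]
  have hcp : ∀ K b h : ℕ, ∃ P, b ∈ B → 1 ≤ h → ∀ p ≥ P, ∀ S : Finset (ℕ × ℕ), (∀ z ∈ S, z.2 < z.1 ∧
      NearSpec (Ak β K) (Qk β K) (Uk β K) p ((h:ℤ) * ((b:ℤ)^z.1 - (b:ℤ)^z.2))) →
      ∑ z ∈ S, (1:ℝ) / (z.1:ℝ)^2 ≤ 1000 / (Uk β K : ℕ) := by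
    intro K b h
    by_cases hb : b ∈ B
    · by_cases hh : 1 ≤ h
      · have irr : Irrational (Real.log b / Real.log (Ak β K : ℕ)) := by
          have h1 := hcompat b hb _ (hβB K)
          have h2 : Real.log b / Real.log (Ak β K : ℕ) = Real.log b / Real.log (β K) / (((K+7)^2 : ℕ) : ℝ) := by
            unfold Ak
            rw [Nat.cast_pow, Real.log_pow, div_div, mul_comm]
          rw [h2]
          exact h1.div_natCast (by positivity)
        obtain ⟨P, hP⟩ := count_pairs (hB b hb) hh (Uk_ge64 hβ K) (Qk_ge hβ K) (Ak_eq β K) irr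
        exact ⟨P, fun _ _ => hP⟩
      · exact ⟨0, fun _ h => absurd h hh⟩
    · exact ⟨0, fun h => absurd h hb⟩
  choose f hf using hcp
  set P0 : ℕ → ℕ := fun K => ∑ b ∈ range (K+1), ∑ h ∈ range (K+1), f K b h with hP0
  have hfP : ∀ K b h, b ≤ K → h ≤ K → f K b h ≤ P0 K := by
    intro K b h hb hh
    have h1 : f K b h ≤ ∑ h ∈ range (K+1), f K b h :=
      single_le_sum (f := fun h => f K b h) (fun _ _ => Nat.zero_le _) (mem_range.2 (by omega))
    have h2 : ∑ h ∈ range (K+1), f K b h ≤ P0 K :=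
      single_le_sum (f := fun b => ∑ h ∈ range (K+1), f K b h) (fun _ _ => Nat.zero_le _) (mem_range.2 (by omega))
    omega
  obtain ⟨μ, hμp, hμ1, hμ2⟩ := exists_limit (P0 := P0) hβ
  have hνp : IsProbabilityMeasure (μ.map Int.fract) :=
    Measure.isProbabilityMeasure_map measurable_fract.aemeasurable
  have hν1 : ∀ l : ℤ, Tendsto (fun K => (((FF β P0 K).coeff l : ℝ) : ℂ)) atTop (nhds (muHat (μ.map Int.fract) l)) := by
    intro l; rw [muHat_map_fract]; exact hμ1 l
  refine ⟨μ.map Int.fract, hνp, ?_, limit_rajchman hβ hν1, ?_⟩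
  · rw [Measure.map_apply measurable_fract measurableSet_Ico.compl]
    convert measure_empty (μ := μ)
    ext x
    simp only [Set.mem_preimage, Set.mem_compl_iff, Set.mem_Ico, Set.mem_empty_iff_false, iff_false, not_not]
    exact ⟨Int.fract_nonneg x, Int.fract_lt_one x⟩
  · have hN : ∀ᵐ x ∂(μ.map Int.fract), ∀ b : ℕ, b ∈ B → IsNormal b x := by
      rw [ae_all_iff]
      intro b
      by_cases hb : b ∈ B
      · have := limit_normal hβ hν1 b (hB b hb) (by
          intro h hh
          refine ⟨max b h, fun K hK p hp => hf K b h hb hh p ?_⟩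
          have := hfP K b h (le_trans (le_max_left _ _) hK) (le_trans (le_max_right _ _) hK)
          exact le_trans this hp)
        filter_upwards [this] with x hx _ using hx
      · exact Eventually.of_forall fun x h => absurd h hb
    have hNN : ∀ᵐ x ∂(μ.map Int.fract), ∀ b : ℕ, b ∈ B' → ¬ IsNormal b x := by
      rw [ae_all_iff]
      intro b
      by_cases hb : b ∈ B'
      · have := limit_nonnormal (P0 := P0) (μ := μ.map Int.fract) hβ (by
          intro G hG hper c hc
          rw [Measure.map_apply measurable_fract hG.measurableSet]
          have : Int.fract ⁻¹' G = G := Set.ext hper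
          rw [this]
          exact hμ2 G hG c hc) b (hB' b hb) (hinf b hb)
        filter_upwards [this] with x hx _ using hx
      · exact Eventually.of_forall fun x h => absurd h hb
    filter_upwards [hN, hNN] with x h1 h2 using ⟨h1, h2⟩

theorem construct_leb : ∃ μ : Measure ℝ, IsProbabilityMeasure μ ∧ μ ((Set.Ico (0:ℝ) 1)ᶜ) = 0 ∧ Rajchman μ ∧
      ∀ᵐ x ∂μ, ∀ b : ℕ, 2 ≤ b → IsNormal b x := by
  have hp : IsProbabilityMeasure (muF 1) := Good.one.muF_prob (by rw [tp_coeff_one]; simp)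
  have hz : ∀ l : ℤ, l ≠ 0 → muHat (muF 1) l = 0 := by
    intro l hl
    rw [Good.one.muHat_muF, tp_coeff_one, if_neg hl, Complex.ofReal_zero]
  refine ⟨muF 1, hp, ?_, ?_, ?_⟩
  · apply withDensity_absolutelyContinuous
    rw [Measure.restrict_apply measurableSet_Ico.compl, Set.compl_inter_self, measure_empty]
  · apply tendsto_const_nhds.congr'
    refine (Set.finite_singleton (0:ℤ)).subset ?_
    intro l hl
    by_contra hc
    exact hl (hz l hc).symm
  · have : ∀ᵐ x ∂(muF 1), ∀ b h : ℕ, 2 ≤ b → 1 ≤ h →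
        Tendsto (fun N => (∑ n∈range N, eneg (h*(b:ℝ)^n*x))/(N:ℂ)) atTop (nhds 0) := by
      rw [ae_all_iff]
      intro b
      rw [ae_all_iff]
      intro h
      by_cases hb : 2 ≤ b
      · by_cases hh : 1 ≤ h
        · have := weyl_ae (muF 1) h b 0 (by
            intro S hS
            apply le_of_eq
            apply sum_eq_zero
            intro z hzS
            rw [hz, norm_zero, zero_div]
            have h1 : (b:ℤ)^z.2 < (b:ℤ)^z.1 := pow_lt_pow_right₀ (by exact_mod_cast (by omega : 1 < b)) (hS z hzS)
            have hh' : (1:ℤ) ≤ h := by exact_mod_cast hh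
            have : 0 < (h:ℤ) * ((b:ℤ)^z.1 - (b:ℤ)^z.2) := by apply mul_pos <;> linarith
            exact this.ne')
          filter_upwards [this] with x hx _ _ using hx
        · exact Eventually.of_forall fun x _ hc => absurd hc hh
      · exact Eventually.of_forall fun x hc => absurd hc hb
    filter_upwards [this] with x hx b hb
    exact weyl_normal b hb x (fun h hh => hx b h hb hh)

open scoped Classical in
/-- Theorem 1 (Pramanik–Zhang): for every compatible pair `(𝔅, 𝔅′)` of base sets
(with the convention that an empty set on one side is replaced by all bases on the
other side), there exists a Rajchman probability measure supported on `[0,1)` almost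
all of whose points are normal in every base of `𝔅` and non-normal in every base
of `𝔅′`. -/
theorem rajchman_measure_on_partly_normal_numbers
    (B B' : Set ℕ)
    (hB : ∀ b ∈ B, 2 ≤ b) (hB' : ∀ b ∈ B', 2 ≤ b)
    (hne : (B ∪ B').Nonempty)
    (hcompat : ∀ b ∈ B, ∀ b' ∈ B', Irrational (Real.log b / Real.log b')) :
    ∃ μ : Measure ℝ, IsProbabilityMeasure μ ∧ μ ((Set.Ico (0:ℝ) 1)ᶜ) = 0 ∧
      Rajchman μ ∧
      ∀ᵐ x ∂μ,
        (∀ b ∈ (if B' = ∅ then {n : ℕ | 2 ≤ n} else B), IsNormal b x) ∧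
        (∀ b' ∈ (if B = ∅ then {n : ℕ | 2 ≤ n} else B'), ¬ IsNormal b' x) := by
  by_cases h1 : B' = ∅
  · subst h1
    rw [Set.union_empty] at hne
    obtain ⟨μ, m1, m2, m3, m4⟩ := construct_leb
    refine ⟨μ, m1, m2, m3, ?_⟩
    rw [if_pos rfl, if_neg hne.ne_empty]
    filter_upwards [m4] with x hx
    exact ⟨fun b hb => hx b hb, fun b hb => absurd hb (Set.notMem_empty b)⟩
  · by_cases h2 : B = ∅
    · subst h2
      rw [if_neg h1, if_pos rfl]
      exact construct ∅ {n : ℕ | 2 ≤ n} hB (fun b hb => hb) ⟨2, le_refl 2⟩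
        (fun b hb => absurd hb (Set.notMem_empty b))
    · rw [if_neg h1, if_neg h2]
      exact construct B B' hB hB' (Set.nonempty_iff_ne_empty.2 h1) hcompat
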